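/- Let m ≥ 2, let K ∈ H_m^𝓡 be a resonant homogeneous polynomial of degree 2m, let z ∈ 𝒢 and N ≥ 1. Then ∑_{ℓ∈ℤ, |ℓ| ≥ mN²} e^{σ|ℓ|^θ} · |{I_ℓ, K}(z)|^{1/2} ≤ √2 · ‖K‖_{ℓ∞}^{1/2} · e^{−σ(1−θ)N^θ/2} · ‖z‖_σ^{m}. -/

import Mathlib

noncomputable section

attribute [local instance] Classical.propDecidable

open scoped BigOperators

/-- The Gevrey weight `e^(σ |a|^θ)`. -/
def wt (σ θ : ℝ) (a : ℤ) : ℝ := Real.exp (σ * |(a : ℝ)| ^ θ)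

/-- The Gevrey norm `‖z‖_σ = 2 ∑_a e^(σ|a|^θ) |z_a|`. -/
def gNorm (σ θ : ℝ) (z : ℤ → ℂ) : ℝ := 2 * ∑' a : ℤ, wt σ θ a * ‖z a‖

/-- Membership in the Gevrey space `𝒢`. -/
def inG (σ θ : ℝ) (z : ℤ → ℂ) : Prop := Summable fun a : ℤ => wt σ θ a * ‖z a‖

/-- `z_{(δ,a)}`: `z_a` if `δ = 1`, the conjugate if `δ = -1`. -/
def idxVal (z : ℤ → ℂ) (p : ℤ × ℤ) : ℂ :=
  if p.1 = 1 then z p.2 else (starRingEnd ℂ) (z p.2)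

/-- The monomial `z_𝐣`. -/
def zProd {n : ℕ} (z : ℤ → ℂ) (j : Fin n → ℤ × ℤ) : ℂ := ∏ α, idxVal z (j α)

/-- The signs of the multi-index belong to `𝕌₂ = {-1, 1}`. -/
def isU2 {n : ℕ} (j : Fin n → ℤ × ℤ) : Prop := ∀ α, (j α).1 = 1 ∨ (j α).1 = -1

/-- Zero momentum multi-indices (the set `M_m`, with `n = 2m`). -/
def inM {n : ℕ} (j : Fin n → ℤ × ℤ) : Prop :=
  isU2 j ∧ ∑ α, (j α).1 = 0 ∧ ∑ α, (j α).1 * (j α).2 = 0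

/-- Resonant multi-indices (the set `R_m`, with `n = 2m`). -/
def inR {n : ℕ} (j : Fin n → ℤ × ℤ) : Prop :=
  inM j ∧ ∑ α, (j α).1 * (j α).2 ^ 2 = 0

/-- Integrable multi-indices: the entries can be paired as `{(δ,a), (-δ,a)}`. -/
def integ {n : ℕ} (j : Fin n → ℤ × ℤ) : Prop :=
  ∃ φ : Equiv.Perm (Fin n), ∀ α, j (φ α) = (-(j α).1, (j α).2)

/-- `⟨a⟩ = max(1, |a|)`. -/
def brk (a : ℤ) : ℕ := max 1 a.natAbs

/-- The modulated frequencies `ω_𝐣^M(z)` with finite cut-off `M`. -/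
def omegaM (M : ℝ) {n : ℕ} (j : Fin n → ℤ × ℤ) (z : ℤ → ℂ) : ℝ :=
  ∑ β, ((j β).1 : ℝ) *
    ∑' a : ℤ, if a ≠ (j β).2 ∧ |(a : ℝ)| ≤ M then
      ‖z a‖ ^ 2 / ((a : ℝ) - ((j β).2 : ℝ)) ^ 2 else 0

/-- The modulated frequencies `ω_𝐣^∞(z)`. -/
def omegaInf {n : ℕ} (j : Fin n → ℤ × ℤ) (z : ℤ → ℂ) : ℝ :=
  ∑ β, ((j β).1 : ℝ) *
    ∑' a : ℤ, if a ≠ (j β).2 then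
      ‖z a‖ ^ 2 / ((a : ℝ) - ((j β).2 : ℝ)) ^ 2 else 0

/-- The projection `Π_M` on the modes `|a| ≤ M`. -/
def PiM (M : ℝ) (z : ℤ → ℂ) : ℤ → ℂ := fun a => if |(a : ℝ)| ≤ M then z a else 0

/-- The optimal order `r_ε`. -/
def rEps (σ θ ε : ℝ) : ℕ :=
  Nat.floor ((min 1 σ * θ * (1 - θ) / 500) * Real.log ε⁻¹ / Real.log (Real.log ε⁻¹))

/-- The truncation parameter `N_ε`. -/
def NEps (θ ε : ℝ) : ℝ := Real.log ε⁻¹ ^ ((2 : ℝ) / θ)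

/-- The truncation parameter `L_ε = 6 r_ε N_ε²`. -/
def LEps (σ θ ε : ℝ) : ℝ := 6 * (rEps σ θ ε : ℝ) * NEps θ ε ^ 2

/-- `δ_ε = ε^(5/2)`. -/
def dEps (ε : ℝ) : ℝ := ε ^ ((5 : ℝ) / 2)

/-- Membership in the non-resonant set `𝔙_δ^{r,M}`: for every non-integrable resonant
multi-index `𝐣` with at most `r` entries and `μ₁(𝐣) ≤ M`, one has `|ω_𝐣^M(z)| > δ`. -/
def inV (δ r M : ℝ) (z : ℤ → ℂ) : Prop :=
  ∀ m : ℕ, 1 ≤ m → ∀ j : Fin (2 * m) → ℤ × ℤ,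
    inR j → ¬ integ j → (2 * m : ℝ) ≤ r → (∀ β, (brk ((j β).2) : ℝ) ≤ M) →
    δ < |omegaM M j z|

/-- The set `Θ_ε` of good initial data. -/
def inTheta (σ θ ε : ℝ) (z : ℤ → ℂ) : Prop :=
  inV (10 * dEps ε) (6 * (rEps σ θ ε : ℝ)) (LEps σ θ ε) (PiM (LEps σ θ ε) z)


/-- The `ℓ∞` norm of the coefficients of a polynomial. -/
def supNorm {n : ℕ} (P : (Fin n → ℤ × ℤ) → ℂ) : ℝ := ⨆ j, ‖P j‖

/-- Membership in `H_m^𝓡` (with `n = 2m`): reality, symmetry, finite `ℓ∞` norm and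
support in the resonant multi-indices `R_m`. -/
def inHR {n : ℕ} (K : (Fin n → ℤ × ℤ) → ℂ) : Prop :=
  (∀ j : Fin n → ℤ × ℤ, (starRingEnd ℂ) (K j) = K (fun α => (-(j α).1, (j α).2))) ∧
  (∀ (j : Fin n → ℤ × ℤ) (φ : Equiv.Perm (Fin n)), K (j ∘ φ) = K j) ∧
  BddAbove (Set.range fun j => ‖K j‖) ∧
  (∀ j : Fin n → ℤ × ℤ, K j ≠ 0 → inR j)

/-- The Poisson bracket `{I_ℓ, K}(z) = ∑_𝐣 K_𝐣 ⬝ i(n₋(𝐣,ℓ) - n₊(𝐣,ℓ)) ⬝ z_𝐣`. -/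
def actionBracket {n : ℕ} (K : (Fin n → ℤ × ℤ) → ℂ) (ℓ : ℤ) (z : ℤ → ℂ) : ℂ :=
  ∑' j : Fin n → ℤ × ℤ,
    K j * (Complex.I *
      (((Finset.univ.filter fun α => j α = ((-1 : ℤ), ℓ)).card : ℂ) -
        ((Finset.univ.filter fun α => j α = ((1 : ℤ), ℓ)).card : ℂ))) * zProd z j


/-- The sum of the `t` middle binomial coefficients of order `k`, as an odd function of `t`. -/
def midSum (k : ℕ) (t : ℤ) : ℤ :=
  ∑ ij ∈ Finset.HasAntidiagonal.antidiagonal k, (k.choose ij.1 : ℤ) * (t + ij.2 - ij.1).sign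

lemma midSum_zero (t : ℤ) : midSum 0 t = t.sign := by
  simp [midSum]

lemma midSum_swap (k : ℕ) (t : ℤ) :
    midSum k t =
      ∑ ij ∈ Finset.HasAntidiagonal.antidiagonal k, (k.choose ij.1 : ℤ) * (t + ij.1 - ij.2).sign := by
  rw [midSum, ← Finset.Nat.sum_antidiagonal_swap]
  refine Finset.sum_congr rfl fun ij hij => ?_
  rw [Finset.HasAntidiagonal.mem_antidiagonal] at hij
  simp only [Prod.fst_swap, Prod.snd_swap]
  rw [Nat.choose_symm_of_eq_add hij.symm]

lemma midSum_neg (k : ℕ) (t : ℤ) : midSum k (-t) = -midSum k t := by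
  rw [midSum_swap, midSum, ← Finset.sum_neg_distrib]
  refine Finset.sum_congr rfl fun ij _ => ?_
  rw [show -t + ij.1 - ij.2 = -(t + (ij.2 : ℤ) - ij.1) by ring, Int.sign_neg]
  ring

lemma midSum_at_zero (k : ℕ) : midSum k 0 = 0 := by
  have := midSum_neg k 0
  rw [neg_zero] at this
  omega

lemma midSum_succ (k : ℕ) (t : ℤ) :
    midSum (k + 1) t = midSum k (t - 1) + midSum k (t + 1) := by
  have h := Finset.sum_antidiagonal_choose_succ_mul
    (fun i j : ℕ => (t + (j : ℤ) - i).sign) k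
  rw [midSum, h, add_comm, midSum, midSum]
  congr 1
  · refine Finset.sum_congr rfl fun ij hij => ?_
    rw [Finset.HasAntidiagonal.mem_antidiagonal] at hij
    rw [Nat.choose_symm_of_eq_add hij.symm]
    push_cast
    ring_nf
  · refine Finset.sum_congr rfl fun ij _ => ?_
    push_cast
    ring_nf

lemma two_mul_midSum_one (k : ℕ) :
    2 * midSum k 1 = ∑ ij ∈ Finset.HasAntidiagonal.antidiagonal k,
      (k.choose ij.1 : ℤ) * ((1 + (ij.2 : ℤ) - ij.1).sign + (1 + (ij.1 : ℤ) - ij.2).sign) := by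
  rw [two_mul]
  nth_rewrite 2 [midSum_swap]
  rw [midSum, ← Finset.sum_add_distrib]
  simp only [mul_add]

lemma midSum_one_even (i : ℕ) : midSum (2 * i) 1 = (2 * i).choose i := by
  have h := two_mul_midSum_one (2 * i)
  rw [Finset.sum_eq_single (i, i)] at h
  · norm_num at h
    omega
  · rintro ⟨a, b⟩ hab hne
    rw [Finset.HasAntidiagonal.mem_antidiagonal] at hab
    simp only at hab ⊢
    rcases lt_trichotomy a b with hlt | heq | hgt
    · rw [Int.sign_eq_one_of_pos (by omega), Int.sign_eq_neg_one_of_neg (by omega)]; simp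
    · exact absurd (by ext <;> simp <;> omega) hne
    · rw [Int.sign_eq_neg_one_of_neg (by omega), Int.sign_eq_one_of_pos (by omega)]; simp
  · intro h; exact absurd (by simp; omega) h

lemma midSum_one_odd (i : ℕ) : midSum (2 * i + 1) 1 = (2 * i + 1).choose i := by
  have h := two_mul_midSum_one (2 * i + 1)
  rw [Finset.sum_eq_add (i, i + 1) (i + 1, i)] at h
  · have e : (2 * i + 1).choose (i + 1) = (2 * i + 1).choose i :=
      Nat.choose_symm_of_eq_add (by omega)
    simp only [e] at h
    rw [show (1 + ((i + 1 : ℕ) : ℤ) - (i : ℕ)) = 2 by push_cast; ring,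
      show (1 + ((i : ℕ) : ℤ) - ((i + 1 : ℕ) : ℤ)) = 0 by push_cast; ring] at h
    norm_num [show (2 : ℤ).sign = 1 from rfl] at h
    omega
  · simp
  · rintro ⟨a, b⟩ hab ⟨hne, hne'⟩
    rw [Finset.HasAntidiagonal.mem_antidiagonal] at hab
    simp only [ne_eq, Prod.mk.injEq] at hab hne hne' ⊢
    rcases lt_or_ge (a + 1) b with hlt | hge
    · rw [Int.sign_eq_one_of_pos (by omega), Int.sign_eq_neg_one_of_neg (by omega)]; simp
    · rw [Int.sign_eq_neg_one_of_neg (by omega), Int.sign_eq_one_of_pos (by omega)]; simp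
  · intro h; exact absurd (by simp; omega) h
  · intro h; exact absurd (by simp; omega) h

lemma centralBinom_sq_mul_le (k : ℕ) : k.centralBinom ^ 2 * (3 * k + 1) ≤ 16 ^ k := by
  induction k with
  | zero => simp
  | succ k ih =>
    have h := Nat.succ_mul_centralBinom_succ k
    have hpos : 0 < (k + 1) ^ 2 * (3 * k + 1) := by positivity
    refine Nat.le_of_mul_le_mul_left ?_ hpos
    calc (k + 1) ^ 2 * (3 * k + 1) * ((k + 1).centralBinom ^ 2 * (3 * (k + 1) + 1))
        = ((k + 1) * (k + 1).centralBinom) ^ 2 * (3 * k + 1) * (3 * k + 4) := by ring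
      _ = 4 * (2 * k + 1) ^ 2 * (3 * k + 4) * (k.centralBinom ^ 2 * (3 * k + 1)) := by
        rw [h]; ring
      _ ≤ 4 * (2 * k + 1) ^ 2 * (3 * k + 4) * 16 ^ k := Nat.mul_le_mul_left _ ih
      _ ≤ (16 * ((k + 1) ^ 2 * (3 * k + 1))) * 16 ^ k := by
        refine Nat.mul_le_mul_right _ ?_
        nlinarith
      _ = (k + 1) ^ 2 * (3 * k + 1) * 16 ^ (k + 1) := by ring

lemma midSum_two_sq_mul_le (k : ℕ) : midSum k 2 ^ 2 * (3 * (k + 1)) ≤ 8 * 4 ^ k := by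
  have h2 : midSum k 2 = midSum (k + 1) 1 := by
    rw [midSum_succ]; simp [midSum_at_zero]
  rw [h2]
  rcases Nat.even_or_odd' (k + 1) with ⟨i, hi | hi⟩
  · rw [hi, midSum_one_even]
    obtain ⟨j, rfl⟩ : ∃ j, i = j + 1 := ⟨i - 1, by omega⟩
    have hk : k = 2 * j + 1 := by omega
    subst hk
    have := centralBinom_sq_mul_le (j + 1)
    rw [Nat.centralBinom_eq_two_mul_choose] at this
    zify at this
    push_cast
    rw [show (8 : ℤ) * 4 ^ (2 * j + 1) = 2 * 16 ^ (j + 1) by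
      rw [show (16 : ℤ) = 4 ^ 2 by norm_num, ← pow_mul]; ring]
    nlinarith [sq_nonneg (((2 * (j + 1)).choose (j + 1) : ℕ) : ℤ)]
  · have hk : k = 2 * i := by omega
    subst hk
    rw [midSum_one_odd]
    have := centralBinom_sq_mul_le (i + 1)
    have e : (i + 1).centralBinom = 2 * (2 * i + 1).choose i := by
      rw [Nat.centralBinom_eq_two_mul_choose, show 2 * (i + 1) = 2 * i + 1 + 1 by ring,
        Nat.choose_succ_succ, Nat.choose_symm_of_eq_add (show 2 * i + 1 = (i + 1) + i by omega)]
      ring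
    rw [e] at this
    zify at this
    rw [show (8 : ℤ) * 4 ^ (2 * i) = 8 * 16 ^ i by rw [pow_mul]; norm_num]
    rw [pow_succ 16 i] at this
    push_cast
    nlinarith [sq_nonneg (((2 * i + 1).choose i : ℕ) : ℤ)]

/-- A list of lattice points, listed from right to left, tracing a concave path whose chords all
have slope at least `τ`. -/
def ConcaveChain (τ : ℤ) (c : List (ℤ × ℤ)) : Prop :=
  (∀ r q, [r, q].Sublist c → q.1 < r.1 ∧ τ * (r.1 - q.1) ≤ r.2 - q.2) ∧
  ∀ r q p, [r, q, p].Sublist c →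
    (r.2 - q.2) * (q.1 - p.1) ≤ (q.2 - p.2) * (r.1 - q.1)

namespace ConcaveChain

lemma mono {τ τ' : ℤ} (h : τ' ≤ τ) {c : List (ℤ × ℤ)} (hc : ConcaveChain τ c) :
    ConcaveChain τ' c := by
  refine ⟨fun r q hrq => ?_, hc.2⟩
  obtain ⟨h1, h2⟩ := hc.1 r q hrq
  exact ⟨h1, by nlinarith⟩

lemma sublist {τ : ℤ} {c c' : List (ℤ × ℤ)} (hc : ConcaveChain τ c) (h : c'.Sublist c) :
    ConcaveChain τ c' :=
  ⟨fun r q hrq => hc.1 r q (hrq.trans h), fun r q p hs => hc.2 r q p (hs.trans h)⟩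

lemma map_add {τ : ℤ} {c : List (ℤ × ℤ)} (hc : ConcaveChain τ c) (w : ℤ × ℤ) :
    ConcaveChain τ (c.map (· + w)) := by
  constructor
  · intro r q h
    obtain ⟨l, hl, e⟩ := List.sublist_map_iff.1 h
    match l, e with
    | [r', q'], e =>
      simp only [List.map_cons, List.map_nil, List.cons.injEq, and_true] at e
      obtain ⟨rfl, rfl⟩ := e
      simpa using hc.1 r' q' hl
  · intro r q p h
    obtain ⟨l, hl, e⟩ := List.sublist_map_iff.1 h
    match l, e with
    | [r', q', p'], e =>
      simp only [List.map_cons, List.map_nil, List.cons.injEq, and_true] at e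
      obtain ⟨rfl, rfl, rfl⟩ := e
      simpa using hc.2 r' q' p' hl

lemma cons_add {τ x : ℤ} (hx : 0 < x) {q : ℤ × ℤ} {c : List (ℤ × ℤ)}
    (hc : ConcaveChain τ (q :: c)) : ConcaveChain τ ((q + (x, x * τ)) :: q :: c) := by
  constructor
  · intro r q' h
    rcases List.cons_sublist_cons'.1 h with h1 | ⟨rfl, h1⟩
    · exact hc.1 r q' h1
    · rcases List.cons_sublist_cons'.1 h1 with h2 | ⟨rfl, -⟩
      · obtain ⟨h1, h2⟩ := hc.1 q q' (h2.cons_cons q)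
        simp only [Prod.fst_add, Prod.snd_add]
        exact ⟨by linarith, by linarith⟩
      · simp only [Prod.fst_add, Prod.snd_add]
        exact ⟨by linarith, by linarith⟩
  · intro r q' p h
    rcases List.cons_sublist_cons'.1 h with h1 | ⟨rfl, h1⟩
    · exact hc.2 r q' p h1
    · simp only [Prod.fst_add, Prod.snd_add]
      obtain ⟨-, h2⟩ := hc.1 q' p h1
      rcases List.cons_sublist_cons'.1 h1 with h3 | ⟨rfl, -⟩
      · have h4 := hc.2 q q' p (h3.cons_cons q)
        nlinarith
      · nlinarith

/-- A concave chain meets a strictly convex parabola at most twice. -/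
lemma countP_parabola_le {τ : ℤ} {c : List (ℤ × ℤ)} (hc : ConcaveChain τ c) (w : ℤ × ℤ) :
    (c.map fun p => if p.2 + w.2 = (p.1 + w.1) ^ 2 then 1 else 0).sum ≤ min 2 c.length := by
  have e : (c.map fun p => if p.2 + w.2 = (p.1 + w.1) ^ 2 then 1 else 0).sum
      = (c.filter fun p => p.2 + w.2 = (p.1 + w.1) ^ 2).length := by
    clear hc
    induction c with
    | nil => simp
    | cons a c ih =>
      rw [List.map_cons, List.sum_cons, ih, List.filter_cons]
      by_cases h : a.2 + w.2 = (a.1 + w.1) ^ 2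
      · rw [if_pos h, if_pos (by simpa using h), List.length_cons, add_comm]
      · rw [if_neg h, if_neg (by simpa using h), zero_add]
  rw [e]
  refine le_min ?_ (List.length_filter_le _ _)
  by_contra! hlt
  rcases hf : c.filter fun p => p.2 + w.2 = (p.1 + w.1) ^ 2 with _ | ⟨r, _ | ⟨q, _ | ⟨p, l⟩⟩⟩
  · simp [hf] at hlt
  · simp [hf] at hlt
  · simp [hf] at hlt
  · have hsub : [r, q, p].Sublist c := by
      refine List.Sublist.trans ?_ (List.filter_sublist (p := fun p => p.2 + w.2 = (p.1 + w.1) ^ 2))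
      rw [hf]
      simp
    have hmem : ∀ v ∈ [r, q, p], v.2 + w.2 = (v.1 + w.1) ^ 2 := by
      intro v hv
      have : v ∈ c.filter fun p => p.2 + w.2 = (p.1 + w.1) ^ 2 := by
        rw [hf]
        simp only [List.mem_cons, List.not_mem_nil, or_false] at hv ⊢
        tauto
      simpa using (List.mem_filter.1 this).2
    have hr := hmem r (by simp)
    have hq := hmem q (by simp)
    have hp := hmem p (by simp)
    have h3 := hc.2 r q p hsub
    have h1 := (hc.1 r q (List.Sublist.trans (by simp) hsub)).1
    have h2 := (hc.1 q p (List.Sublist.trans (by simp) hsub)).1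
    have e1 : r.2 - q.2 = (r.1 - q.1) * (r.1 + q.1 + 2 * w.1) := by linear_combination hr - hq
    have e2 : q.2 - p.2 = (q.1 - p.1) * (q.1 + p.1 + 2 * w.1) := by linear_combination hq - hp
    rw [e1, e2] at h3
    have : 0 < (r.1 - q.1) * (q.1 - p.1) * (r.1 - p.1) :=
      mul_pos (mul_pos (by linarith) (by linarith)) (by linarith)
    nlinarith

end ConcaveChain

/-- The inductive step of the symmetric chain decomposition: each chain `c` is replaced by
`c - v` extended on the right by its end point plus `v`, and by `c + v` without its end point. -/
def splitChains (v : ℤ × ℤ) (L : List (List (ℤ × ℤ))) : List (List (ℤ × ℤ)) :=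
  L.flatMap fun c => match c with
    | [] => []
    | q :: c => [(q + v) :: (q :: c).map (· + -v), c.map (· + v)]

lemma sum_splitChains (v : ℤ × ℤ) (L : List (List (ℤ × ℤ))) (f : ℤ × ℤ → ℕ) :
    ((splitChains v L).map fun c => (c.map f).sum).sum =
      (L.map fun c => (c.map fun p => f (p + -v)).sum).sum +
      (L.map fun c => (c.map fun p => f (p + v)).sum).sum := by
  induction L with
  | nil => simp [splitChains]
  | cons c L ih =>
    have e : splitChains v (c :: L) = splitChains v [c] ++ splitChains v L := by
      simp [splitChains]
    rw [e, List.map_append, List.sum_append, ih]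
    cases c with
    | nil => simp [splitChains]
    | cons q c =>
      simp [splitChains, Function.comp_def]
      ring

lemma sum_min_splitChains (v : ℤ × ℤ) (L : List (List (ℤ × ℤ))) (t : ℕ) :
    ((splitChains v L).map fun c => min (t + 1) c.length).sum =
      (L.map fun c => min t c.length).sum + (L.map fun c => min (t + 2) c.length).sum := by
  induction L with
  | nil => simp [splitChains]
  | cons c L ih =>
    have e : splitChains v (c :: L) = splitChains v [c] ++ splitChains v L := by
      simp [splitChains]
    rw [e, List.map_append, List.sum_append, ih]
    cases c with
    | nil => simp [splitChains]
    | cons q c =>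
      simp [splitChains]
      omega

lemma concaveChain_splitChains {τ x : ℤ} (hx : 0 < x) {L : List (List (ℤ × ℤ))}
    (hL : ∀ c ∈ L, ConcaveChain τ c) : ∀ c ∈ splitChains (x, x * τ) L, ConcaveChain τ c := by
  intro c hc
  obtain ⟨d, hd, hcd⟩ := List.mem_flatMap.1 hc
  have hd' := hL d hd
  match d, hcd with
  | q :: d, hcd =>
    simp only [List.mem_cons, List.not_mem_nil, or_false] at hcd
    rcases hcd with rfl | rfl
    · have := (hd'.map_add (-(x, x * τ)))
      rw [List.map_cons] at this
      have := this.cons_add (show 0 < 2 * x by linarith)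
      convert this using 2
      · ext <;> simp <;> ring
      · simp
    · exact (hd'.sublist (List.sublist_cons_self q d)).map_add _

/-- Chain decomposition of the signed sums of the vectors `x i • (1, τ i)`. -/
lemma exists_concave_chains {ι : Type*} [DecidableEq ι] (x τ : ι → ℤ) (s : Finset ι) :
    ∃ L : List (List (ℤ × ℤ)),
      (∀ f : ℤ × ℤ → ℕ, ∑ A ∈ s.powerset,
        f (∑ i ∈ s, if i ∈ A then (x i, x i * τ i) else -(x i, x i * τ i)) =
          (L.map fun c => (c.map f).sum).sum) ∧
      (∀ t : ℕ, (((L.map fun c => min t c.length).sum : ℕ) : ℤ) =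
        2 ^ (s.filter fun i => x i = 0).card * midSum (s.filter fun i => x i ≠ 0).card t) ∧
      ∀ σ, (∀ i ∈ s, σ ≤ τ i) → ∀ c ∈ L, ConcaveChain σ c := by
  induction s using Finset.induction_on_min_value τ with
  | empty =>
    refine ⟨[[0]], by simp, fun t => ?_, fun σ _ c hc => ?_⟩
    · simp only [List.map_cons, List.length_singleton, List.map_nil, List.sum_cons, List.sum_nil,
        Finset.filter_empty, Finset.card_empty, midSum_zero]
      rcases t with _ | t
      · simp
      · rw [Int.sign_eq_one_of_pos (by positivity)]; simp
    · rw [List.mem_singleton.1 hc]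
      refine ⟨fun r q h => ?_, fun r q p h => ?_⟩ <;>
        exact absurd h.length_le (by simp)
  | insert a s ha hmin ih =>
    obtain ⟨L, hsum, hlen, hconc⟩ := ih
    have hconc' := hconc (τ a) hmin
    have hsum' : ∀ f : ℤ × ℤ → ℕ, ∑ A ∈ (insert a s).powerset,
        f (∑ i ∈ insert a s, if i ∈ A then (x i, x i * τ i) else -(x i, x i * τ i)) =
          (L.map fun c => (c.map fun p => f (p + -(x a, x a * τ a))).sum).sum +
          (L.map fun c => (c.map fun p => f (p + (x a, x a * τ a))).sum).sum := by
      intro f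
      rw [Finset.sum_powerset_insert ha, ← hsum, ← hsum]
      congr 1
      · refine Finset.sum_congr rfl fun A hA => ?_
        have haA : a ∉ A := fun h => ha (Finset.mem_powerset.1 hA h)
        rw [Finset.sum_insert ha, if_neg haA, add_comm]
      · refine Finset.sum_congr rfl fun A hA => ?_
        rw [Finset.sum_insert ha, if_pos (Finset.mem_insert_self a A), add_comm]
        congr 2
        refine Finset.sum_congr rfl fun i hi => ?_
        have hia : i ≠ a := fun h => ha (h ▸ hi)
        simp [hia]
    have key : ∀ y : ℤ, 0 < y → (∀ f : ℤ × ℤ → ℕ,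
        (L.map fun c => (c.map fun p => f (p + -(x a, x a * τ a))).sum).sum +
          (L.map fun c => (c.map fun p => f (p + (x a, x a * τ a))).sum).sum =
        (L.map fun c => (c.map fun p => f (p + -(y, y * τ a))).sum).sum +
          (L.map fun c => (c.map fun p => f (p + (y, y * τ a))).sum).sum) → x a ≠ 0 →
        ∃ L : List (List (ℤ × ℤ)),
          (∀ f : ℤ × ℤ → ℕ, ∑ A ∈ (insert a s).powerset,
            f (∑ i ∈ insert a s, if i ∈ A then (x i, x i * τ i) else -(x i, x i * τ i)) =
              (L.map fun c => (c.map f).sum).sum) ∧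
          (∀ t : ℕ, (((L.map fun c => min t c.length).sum : ℕ) : ℤ) =
            2 ^ ((insert a s).filter fun i => x i = 0).card *
              midSum ((insert a s).filter fun i => x i ≠ 0).card t) ∧
          ∀ σ, (∀ i ∈ insert a s, σ ≤ τ i) → ∀ c ∈ L, ConcaveChain σ c := by
      intro y hy hf hxa
      refine ⟨splitChains (y, y * τ a) L, fun f => ?_, fun t => ?_, fun σ hσ c hc => ?_⟩
      · rw [hsum', sum_splitChains, hf]
      · rw [Finset.filter_insert, if_neg hxa, Finset.filter_insert, if_pos hxa,
          Finset.card_insert_of_notMem (by simp [ha])]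
        rcases t with _ | t
        · simp [midSum_at_zero]
        · rw [sum_min_splitChains, midSum_succ]
          have h2 := hlen (t + 2)
          rw [Nat.cast_add, hlen t, h2]
          push_cast
          ring_nf
      · exact (concaveChain_splitChains hy hconc' c hc).mono (hσ a (Finset.mem_insert_self a s))
    rcases lt_trichotomy (x a) 0 with hx | hx | hx
    · refine key (-x a) (by linarith) (fun f => ?_) hx.ne
      have e : ((-x a, -x a * τ a) : ℤ × ℤ) = -(x a, x a * τ a) := by
        ext <;> simp
      rw [e, neg_neg, add_comm]
    · refine ⟨L ++ L, fun f => ?_, fun t => ?_, fun σ hσ c hc => ?_⟩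
      · rw [hsum']
        have e : ((x a, x a * τ a) : ℤ × ℤ) = 0 := by rw [hx]; simp
        simp [e]
      · rw [Finset.filter_insert, if_pos hx, Finset.filter_insert, if_neg (by simpa using hx),
          Finset.card_insert_of_notMem (by simp [ha])]
        rw [List.map_append, List.sum_append]
        rw [Nat.cast_add, hlen t]
        ring
      · refine (hconc' c ?_).mono (hσ a (Finset.mem_insert_self a s))
        simpa using hc
    · exact key (x a) hx (fun f => rfl) hx.ne'

/-- A Littlewood-Offord bound: number of signed sums of the vectors `x i • (1, τ i)` lying on a
translated parabola. -/
lemma card_signs_parabola_le {ι : Type*} [DecidableEq ι] (x τ : ι → ℤ) (s : Finset ι) (w : ℤ × ℤ) :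
    ((∑ A ∈ s.powerset,
      if (∑ i ∈ s, if i ∈ A then (x i, x i * τ i) else -(x i, x i * τ i)).2 + w.2 =
        ((∑ i ∈ s, if i ∈ A then (x i, x i * τ i) else -(x i, x i * τ i)).1 + w.1) ^ 2
      then 1 else 0 : ℕ) : ℤ) ≤
      2 ^ (s.filter fun i => x i = 0).card * midSum (s.filter fun i => x i ≠ 0).card 2 := by
  obtain ⟨L, hsum, hlen, hconc⟩ := exists_concave_chains x τ s
  have h2 := hlen 2
  rw [Nat.cast_ofNat] at h2
  obtain ⟨σ, hσ⟩ : ∃ σ, ∀ i ∈ s, σ ≤ τ i := by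
    obtain ⟨σ, hσ⟩ := (s.image τ).bddBelow
    exact ⟨σ, fun i hi => hσ (by simpa using ⟨i, hi, rfl⟩)⟩
  rw [hsum (fun p => if p.2 + w.2 = (p.1 + w.1) ^ 2 then 1 else 0), ← h2]
  have := List.sum_le_sum fun c hc => (hconc σ hσ c hc).countP_parabola_le w
  exact Nat.cast_le.2 this

lemma sum_ite_sub_eq_le {X G : Type*} [Fintype X] [AddCommGroup G] [DecidableEq G] (T : X → G) (U : X → ℝ)
    (w : G) :
    ∑ x, ∑ y, (if T x - T y = w then U x * U y else 0) ≤
      ∑ x, ∑ y, (if T x - T y = 0 then U x * U y else 0) := by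
  set g : G → ℝ := fun t => ∑ x, if T x = t then U x else 0 with hg
  set I : Finset G := Finset.univ.image T with hI
  have key : ∀ w : G, ∑ x, ∑ y, (if T x - T y = w then U x * U y else 0) =
      ∑ t ∈ I, g (t + w) * g t := by
    intro w
    rw [Finset.sum_comm, ← Finset.sum_fiberwise_of_maps_to
      (fun y _ => Finset.mem_image_of_mem T (Finset.mem_univ y))]
    refine Finset.sum_congr rfl fun t _ => ?_
    simp only [hg]
    conv_rhs => rw [Finset.sum_mul_sum, Finset.sum_comm]
    rw [Finset.sum_filter]
    refine Finset.sum_congr rfl fun y _ => ?_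
    by_cases hy : T y = t
    · subst hy
      simp [sub_eq_iff_eq_add, add_comm]
    · simp [hy]
  have hgI : ∀ t, t ∉ I → g t = 0 := by
    intro t ht
    refine Finset.sum_eq_zero fun x _ => if_neg fun h => ht ?_
    exact h ▸ Finset.mem_image_of_mem T (Finset.mem_univ x)
  have hshift : ∑ t ∈ I, g (t + w) ^ 2 ≤ ∑ t ∈ I, g t ^ 2 := by
    rw [← Finset.sum_image (f := fun t => g t ^ 2) (g := fun t => t + w)
      (fun a _ b _ h => add_right_cancel h)]
    calc ∑ t ∈ I.image (· + w), g t ^ 2 ≤ ∑ t ∈ I ∪ I.image (· + w), g t ^ 2 :=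
          Finset.sum_le_sum_of_subset_of_nonneg Finset.subset_union_right
            fun _ _ _ => sq_nonneg _
      _ = ∑ t ∈ I, g t ^ 2 :=
          (Finset.sum_subset Finset.subset_union_left fun t _ ht => by simp [hgI t ht]).symm
  rw [key, key]
  calc ∑ t ∈ I, g (t + w) * g t ≤ ∑ t ∈ I, (g (t + w) ^ 2 + g t ^ 2) / 2 :=
        Finset.sum_le_sum fun t _ => by linarith [two_mul_le_add_sq (g (t + w)) (g t)]
    _ = (∑ t ∈ I, g (t + w) ^ 2 + ∑ t ∈ I, g t ^ 2) / 2 := by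
        rw [← Finset.sum_div, Finset.sum_add_distrib]
    _ ≤ ∑ t ∈ I, g (t + 0) * g t := by
        simp only [add_zero, ← pow_two]
        linarith

section Pairs

variable {β : Type*}

/-- The (momentum, energy) vector of a pair of modes. -/
def pairMom (v : β → ℤ) (p : β × β) : ℤ × ℤ :=
  (v p.1 - v p.2, v p.1 ^ 2 - v p.2 ^ 2)

/-- The weight of a tuple of pairs of modes. -/
def pairWt (u : β → ℝ) {n : ℕ} (P : Fin n → β × β) : ℝ :=
  ∏ i, u (P i).1 * u (P i).2

/-- The number of nontrivial pairs. -/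
def numActive {n : ℕ} (P : Fin n → β × β) : ℕ :=
  (Finset.univ.filter fun i => (P i).1 ≠ (P i).2).card

lemma pairMom_swap (v : β → ℤ) (p : β × β) : pairMom v p.swap = -pairMom v p := by
  simp [pairMom]

lemma pairMom_eq_mul (v : β → ℤ) (p : β × β) :
    pairMom v p = (v p.1 - v p.2, (v p.1 - v p.2) * (v p.1 + v p.2)) := by
  simp only [pairMom, Prod.mk.injEq, true_and]; ring

lemma pairWt_nonneg {u : β → ℝ} (hu : ∀ b, 0 ≤ u b) {n : ℕ} (P : Fin n → β × β) :
    0 ≤ pairWt u P :=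
  Finset.prod_nonneg fun _ _ => mul_nonneg (hu _) (hu _)

lemma pairWt_insertNth (u : β → ℝ) {n : ℕ} (i : Fin (n + 1)) (p : β × β) (P : Fin n → β × β) :
    pairWt u (i.insertNth p P : Fin (n + 1) → β × β) = u p.1 * u p.2 * pairWt u P := by
  simp [pairWt, Fin.prod_univ_succAbove _ i]

lemma numActive_insertNth {n : ℕ} (i : Fin (n + 1)) (p : β × β) (P : Fin n → β × β) :
    numActive (i.insertNth p P : Fin (n + 1) → β × β) =
      (if p.1 ≠ p.2 then 1 else 0) + numActive P := by
  simp only [numActive, Finset.card_filter]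
  simp [Fin.sum_univ_succAbove _ i]

/-- Swap the entries of the pairs outside `A`. -/
def swapOff {n : ℕ} (A : Finset (Fin n)) (P : Fin n → β × β) : Fin n → β × β :=
  fun i => if i ∈ A then P i else (P i).swap

lemma swapOff_involutive {n : ℕ} (A : Finset (Fin n)) :
    Function.Involutive (swapOff (β := β) A) := by
  intro P
  funext i
  by_cases h : i ∈ A <;> simp [swapOff, h]

lemma pairWt_swapOff (u : β → ℝ) {n : ℕ} (A : Finset (Fin n)) (P : Fin n → β × β) :
    pairWt u (swapOff A P) = pairWt u P := by
  refine Finset.prod_congr rfl fun i _ => ?_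
  by_cases h : i ∈ A <;> simp [swapOff, h, mul_comm]

lemma sum_pairMom_swapOff (v : β → ℤ) {n : ℕ} (A : Finset (Fin n)) (P : Fin n → β × β) :
    ∑ i, pairMom v (swapOff A P i) =
      ∑ i, if i ∈ A then pairMom v (P i) else -pairMom v (P i) := by
  refine Finset.sum_congr rfl fun i _ => ?_
  by_cases h : i ∈ A <;> simp [swapOff, h, pairMom_swap]

variable [Fintype β]

/-- The weighted number of tuples of `n` pairs of modes with given total momentum and energy. -/
def pairCount (v : β → ℤ) (u : β → ℝ) (n : ℕ) (w : ℤ × ℤ) : ℝ :=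
  ∑ P : Fin n → β × β, if ∑ i, pairMom v (P i) = w then pairWt u P else 0

/-- The dispersive bound for the sum of `pairCount` along a parabola. -/
def parabolaBound (u : β → ℝ) (n : ℕ) : ℝ :=
  ∑ P : Fin n → β × β, pairWt u P * (√(8 / 3) / √(numActive P + 1))

lemma pairCount_nonneg (v : β → ℤ) {u : β → ℝ} (hu : ∀ b, 0 ≤ u b) (n : ℕ) (w : ℤ × ℤ) :
    0 ≤ pairCount v u n w :=
  Finset.sum_nonneg fun P _ => by split_ifs <;> simp [pairWt_nonneg hu P]

lemma sum_pairWt (u : β → ℝ) (n : ℕ) :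
    ∑ P : Fin n → β × β, pairWt u P = (∑ b, u b) ^ (2 * n) := by
  have h : (∑ p : β × β, u p.1 * u p.2) = (∑ b, u b) ^ 2 := by
    rw [pow_two, Finset.sum_mul_sum, Fintype.sum_prod_type]
  rw [pow_mul, ← h, Fintype.sum_pow]
  rfl

lemma sum_pairs_insertNth {M : Type*} [AddCommMonoid M] {n : ℕ} (i : Fin (n + 1))
    (f : (Fin (n + 1) → β × β) → M) :
    ∑ P, f P = ∑ p : β × β, ∑ P : Fin n → β × β, f (i.insertNth p P) := by
  rw [← (Fin.insertNthEquiv (fun _ => β × β) i).sum_comp, Fintype.sum_prod_type]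
  rfl

lemma pairCount_neg (v : β → ℤ) (u : β → ℝ) (n : ℕ) (w : ℤ × ℤ) :
    pairCount v u n (-w) = pairCount v u n w := by
  rw [pairCount, ← (Equiv.arrowCongr (Equiv.refl (Fin n)) (Equiv.prodComm β β)).sum_comp]
  refine Finset.sum_congr rfl fun P _ => ?_
  simp [Equiv.arrowCongr, pairMom_swap, pairWt, mul_comm]

lemma pairCount_le_zero (v : β → ℤ) (u : β → ℝ) (n : ℕ) (w : ℤ × ℤ) :
    pairCount v u n w ≤ pairCount v u n 0 := by
  have h : ∀ w, pairCount v u n w = ∑ x : Fin n → β, ∑ y : Fin n → β,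
      if ∑ i, (v (x i), v (x i) ^ 2) - ∑ i, (v (y i), v (y i) ^ 2) = w then
        (∏ i, u (x i)) * ∏ i, u (y i) else 0 := by
    intro w
    rw [pairCount, ← Equiv.sum_comp (Equiv.arrowProdEquivProdArrow (Fin n) (fun _ => β)
      (fun _ => β)).symm, Fintype.sum_prod_type]
    refine Finset.sum_congr rfl fun x _ => Finset.sum_congr rfl fun y _ => ?_
    simp [pairWt, Finset.prod_mul_distrib, ← Finset.sum_sub_distrib, pairMom,
      Equiv.arrowProdEquivProdArrow]
  rw [h, h]
  exact sum_ite_sub_eq_le (fun x : Fin n → β => ∑ i, (v (x i), v (x i) ^ 2))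
    (fun x => ∏ i, u (x i)) w

lemma midSum_two_div_le (k : ℕ) : (midSum k 2 : ℝ) / 2 ^ k ≤ √(8 / 3) / √(k + 1) := by
  rw [← Real.sqrt_div (by norm_num)]
  refine Real.le_sqrt_of_sq_le ?_
  rw [div_pow, div_div, div_le_div_iff₀ (by positivity) (by positivity), ← pow_mul, mul_comm k 2,
    pow_mul]
  have := midSum_two_sq_mul_le k
  have h : ((midSum k 2 : ℝ)) ^ 2 * (3 * (k + 1)) ≤ 8 * 4 ^ k := by exact_mod_cast this
  norm_num
  exact h

lemma sum_pairCount_pairMom_le {v : β → ℤ} (hv : Function.Injective v) {u : β → ℝ}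
    (hu : ∀ b, 0 ≤ u b) (n : ℕ) (b : β) :
    ∑ l, pairCount v u n (pairMom v (l, b)) ≤ parabolaBound u n := by
  set φ : (Fin n → β × β) → ℕ := fun P =>
    if (∑ i, pairMom v (P i)).2 + v b ^ 2 = ((∑ i, pairMom v (P i)).1 + v b) ^ 2 then 1 else 0
    with hφ
  have h1 : ∑ l, pairCount v u n (pairMom v (l, b)) ≤
      ∑ P : Fin n → β × β, pairWt u P * φ P := by
    simp only [pairCount]
    rw [Finset.sum_comm]
    refine Finset.sum_le_sum fun P _ => ?_
    have hP := pairWt_nonneg hu P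
    by_cases hex : ∃ l, ∑ i, pairMom v (P i) = pairMom v (l, b)
    · obtain ⟨l, hl⟩ := hex
      rw [Finset.sum_eq_single l]
      · have : φ P = 1 := by
          simp only [hφ]
          rw [hl, if_pos]
          simp [pairMom]
        rw [if_pos hl, this]
        simp
      · intro l' _ hne
        refine if_neg fun h => hne (hv ?_)
        have := congrArg Prod.fst (h.symm.trans hl)
        simpa [pairMom] using this
      · simp
    · push Not at hex
      rw [Finset.sum_eq_zero fun l _ => if_neg (hex l)]
      positivity
  have h2 : ∀ A : Finset (Fin n), ∑ P : Fin n → β × β, pairWt u P * φ P =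
      ∑ P : Fin n → β × β, pairWt u P * φ (swapOff A P) := by
    intro A
    rw [← Equiv.sum_comp (swapOff_involutive A).toPerm]
    simp [pairWt_swapOff]
  have h3 : (2 : ℝ) ^ n * ∑ P : Fin n → β × β, pairWt u P * φ P =
      ∑ P : Fin n → β × β, pairWt u P *
        ((∑ A ∈ (Finset.univ : Finset (Fin n)).powerset, φ (swapOff A P) : ℕ) : ℝ) := by
    have : ∑ A ∈ (Finset.univ : Finset (Fin n)).powerset,
        ∑ P : Fin n → β × β, pairWt u P * φ P = (2 : ℝ) ^ n * ∑ P : Fin n → β × β,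
          pairWt u P * φ P := by
      simp
    rw [← this, Finset.sum_congr rfl fun A _ => h2 A, Finset.sum_comm]
    refine Finset.sum_congr rfl fun P _ => ?_
    rw [Nat.cast_sum, Finset.mul_sum]
  have h4 : ∀ P : Fin n → β × β,
      ((∑ A ∈ (Finset.univ : Finset (Fin n)).powerset, φ (swapOff A P) : ℕ) : ℝ) ≤
        2 ^ n * (√(8 / 3) / √(numActive P + 1)) := by
    intro P
    have h := card_signs_parabola_le (fun i => v (P i).1 - v (P i).2)
      (fun i => v (P i).1 + v (P i).2) (Finset.univ : Finset (Fin n)) (v b, v b ^ 2)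
    have hk : (Finset.univ.filter fun i => v (P i).1 - v (P i).2 ≠ 0).card = numActive P := by
      simp [numActive, sub_eq_zero, hv.eq_iff]
    have hk' : (Finset.univ.filter fun i => v (P i).1 - v (P i).2 = 0).card + numActive P = n := by
      rw [← hk, Finset.card_filter_add_card_filter_not]
      simp
    have hφ' : ∀ A, φ (swapOff A P) = if (∑ i, if i ∈ A then
        (v (P i).1 - v (P i).2, (v (P i).1 - v (P i).2) * (v (P i).1 + v (P i).2)) else
        -(v (P i).1 - v (P i).2, (v (P i).1 - v (P i).2) * (v (P i).1 + v (P i).2))).2 + v b ^ 2 =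
        ((∑ i, if i ∈ A then
        (v (P i).1 - v (P i).2, (v (P i).1 - v (P i).2) * (v (P i).1 + v (P i).2)) else
        -(v (P i).1 - v (P i).2, (v (P i).1 - v (P i).2) * (v (P i).1 + v (P i).2))).1 + v b) ^ 2
        then 1 else 0 := by
      intro A
      simp only [hφ]
      rw [sum_pairMom_swapOff]
      simp only [pairMom_eq_mul]
    rw [hk] at h
    have h' : ((∑ A ∈ (Finset.univ : Finset (Fin n)).powerset, φ (swapOff A P) : ℕ) : ℝ) ≤
        2 ^ (Finset.univ.filter fun i => v (P i).1 - v (P i).2 = 0).card *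
          (midSum (numActive P) 2 : ℝ) := by
      rw [Finset.sum_congr rfl fun A _ => hφ' A]
      exact_mod_cast h
    refine h'.trans ?_
    have h5 := midSum_two_div_le (numActive P)
    rw [div_le_iff₀ (by positivity)] at h5
    calc _ ≤ 2 ^ (Finset.univ.filter fun i => v (P i).1 - v (P i).2 = 0).card *
          (√(8 / 3) / √(numActive P + 1) * 2 ^ numActive P) :=
          mul_le_mul_of_nonneg_left h5 (by positivity)
      _ = 2 ^ ((Finset.univ.filter fun i => v (P i).1 - v (P i).2 = 0).card + numActive P) *
          (√(8 / 3) / √(numActive P + 1)) := by rw [pow_add]; ring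
      _ = _ := by rw [hk']
  refine h1.trans ?_
  refine le_of_mul_le_mul_left ?_ (show (0 : ℝ) < 2 ^ n by positivity)
  rw [h3, parabolaBound, Finset.mul_sum]
  refine Finset.sum_le_sum fun P _ => ?_
  calc _ ≤ pairWt u P * (2 ^ n * (√(8 / 3) / √(numActive P + 1))) :=
        mul_le_mul_of_nonneg_left (h4 P) (pairWt_nonneg hu P)
    _ = _ := by ring

lemma parabolaBound_sq_mul_le {u : β → ℝ} (hu : ∀ b, 0 ≤ u b) (n : ℕ) :
    parabolaBound u n ^ 2 * ((n + 1) * ∑ p : β × β, if p.1 ≠ p.2 then u p.1 * u p.2 else 0) ≤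
      8 / 3 * (∑ b, u b) ^ (2 * n) * (∑ b, u b) ^ (2 * (n + 1)) := by
  set W : ℝ := ∑ P : Fin n → β × β, pairWt u P / (numActive P + 1) with hW
  set R : ℝ := ∑ p : β × β, if p.1 ≠ p.2 then u p.1 * u p.2 else 0 with hR
  have hR0 : 0 ≤ R := Finset.sum_nonneg fun p _ => by
    split_ifs
    · exact mul_nonneg (hu _) (hu _)
    · exact le_rfl
  have h1 : parabolaBound u n ^ 2 ≤ (∑ b, u b) ^ (2 * n) * (8 / 3 * W) := by
    rw [← sum_pairWt, hW, Finset.mul_sum]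
    refine Finset.sum_sq_le_sum_mul_sum_of_sq_le_mul _ (fun P _ => pairWt_nonneg hu P)
      (fun P _ => mul_nonneg (by norm_num) (div_nonneg (pairWt_nonneg hu P) (by positivity)))
      fun P _ => le_of_eq ?_
    rw [mul_pow, div_pow, Real.sq_sqrt (by norm_num), Real.sq_sqrt (by positivity)]
    ring
  have h2 : (n + 1) * R * W ≤ (∑ b, u b) ^ (2 * (n + 1)) := by
    have hi : ∀ i : Fin (n + 1), R * W = ∑ P : Fin (n + 1) → β × β,
        if (P i).1 ≠ (P i).2 then pairWt u P / numActive P else 0 := by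
      intro i
      rw [sum_pairs_insertNth i, hR, hW, Finset.sum_mul_sum]
      refine Finset.sum_congr rfl fun p _ => Finset.sum_congr rfl fun P _ => ?_
      by_cases hp : p.1 = p.2
      · simp [hp]
      · simp [hp, pairWt_insertNth, numActive_insertNth, mul_div_assoc, add_comm]
    have : (n + 1) * R * W = ∑ i : Fin (n + 1), R * W := by
      simp [mul_assoc]
    rw [this, Finset.sum_congr rfl fun i _ => hi i, Finset.sum_comm, ← sum_pairWt]
    refine Finset.sum_le_sum fun P _ => ?_
    rw [← Finset.sum_filter, Finset.sum_const, nsmul_eq_mul]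
    change (numActive P : ℝ) * _ ≤ _
    rcases eq_or_ne (numActive P) 0 with h0 | h0
    · simp [h0, pairWt_nonneg hu P]
    · rw [mul_div_cancel₀]
      exact_mod_cast h0
  calc parabolaBound u n ^ 2 * ((n + 1) * R)
      ≤ (∑ b, u b) ^ (2 * n) * (8 / 3 * W) * ((n + 1) * R) := by gcongr
    _ = 8 / 3 * (∑ b, u b) ^ (2 * n) * ((n + 1) * R * W) := by ring
    _ ≤ _ := by
      have : 0 ≤ ∑ b, u b := Finset.sum_nonneg fun b _ => hu b
      gcongr

end Pairs

section Core

variable {β : Type*} [Fintype β]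

/-- The weighted number of resonant tuples of pairs, counted with the unbalance at the mode `l`. -/
def resonantSum (v : β → ℤ) (u : β → ℝ) (n : ℕ) (l : β) : ℝ :=
  ∑ P : Fin n → β × β, if ∑ i, pairMom v (P i) = 0 then
    |∑ i, ((if (P i).1 = l then 1 else 0) - (if (P i).2 = l then 1 else 0) : ℝ)| * pairWt u P
  else 0

/-- The contribution to `resonantSum` of the resonances in which a given pair contains `l`. -/
def neighborSum (v : β → ℤ) (u : β → ℝ) (n : ℕ) (l : β) : ℝ :=
  ∑ b, if b ≠ l then u b * pairCount v u n (pairMom v (b, l)) else 0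

lemma neighborSum_nonneg (v : β → ℤ) {u : β → ℝ} (hu : ∀ b, 0 ≤ u b) (n : ℕ) (l : β) :
    0 ≤ neighborSum v u n l :=
  Finset.sum_nonneg fun b _ => by
    split_ifs
    · exact mul_nonneg (hu b) (pairCount_nonneg v hu _ _)
    · exact le_rfl

lemma pairCount_pairMom_comm (v : β → ℤ) (u : β → ℝ) (n : ℕ) (b l : β) :
    pairCount v u n (pairMom v (l, b)) = pairCount v u n (pairMom v (b, l)) := by
  rw [← pairCount_neg, ← pairMom_swap]
  rfl

lemma sum_resonant_eq (v : β → ℤ) (u : β → ℝ) (n : ℕ) (i : Fin (n + 1)) (g : β × β → ℝ) :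
    ∑ P : Fin (n + 1) → β × β, (if ∑ i, pairMom v (P i) = 0 then g (P i) * pairWt u P else 0) =
      ∑ p : β × β, g p * (u p.1 * u p.2) * pairCount v u n (pairMom v p) := by
  rw [sum_pairs_insertNth i]
  refine Finset.sum_congr rfl fun p _ => ?_
  rw [← pairCount_neg, pairCount, Finset.mul_sum]
  refine Finset.sum_congr rfl fun P _ => ?_
  rw [Fin.sum_univ_succAbove _ i]
  simp only [Fin.insertNth_apply_same, Fin.insertNth_apply_succAbove, pairWt_insertNth,
    add_eq_zero_iff_eq_neg', mul_ite, mul_zero, mul_assoc]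

lemma resonantSum_le (v : β → ℤ) {u : β → ℝ} (hu : ∀ b, 0 ≤ u b) (n : ℕ) (l : β) :
    resonantSum v u (n + 1) l ≤ 2 * (n + 1) * (u l * neighborSum v u n l) := by
  set g : β × β → ℝ := fun p =>
    (if p.1 = l ∧ p.2 ≠ l then 1 else 0) + (if p.2 = l ∧ p.1 ≠ l then 1 else 0) with hg
  have habs : ∀ p : β × β,
      |((if p.1 = l then 1 else 0) - (if p.2 = l then 1 else 0) : ℝ)| ≤ g p := by
    intro p
    by_cases h1 : p.1 = l <;> by_cases h2 : p.2 = l <;> simp [hg, h1, h2]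
  have hsum : ∑ p : β × β, g p * (u p.1 * u p.2) * pairCount v u n (pairMom v p) =
      2 * (u l * neighborSum v u n l) := by
    simp only [hg, add_mul, Finset.sum_add_distrib, two_mul]
    congr 1
    · rw [Fintype.sum_prod_type, Finset.sum_eq_single l]
      · rw [neighborSum, Finset.mul_sum]
        refine Finset.sum_congr rfl fun b _ => ?_
        by_cases hb : b = l
        · simp [hb]
        · simp [hb, pairCount_pairMom_comm v u n b l, mul_assoc]
      · intro a _ ha
        simp [ha]
      · simp
    · rw [Fintype.sum_prod_type_right, Finset.sum_eq_single l]
      · rw [neighborSum, Finset.mul_sum]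
        refine Finset.sum_congr rfl fun b _ => ?_
        by_cases hb : b = l
        · simp [hb]
        · simp only [hb, ne_eq, not_false_eq_true, and_self, if_true]
          ring
      · intro a _ ha
        simp [ha]
      · simp
  calc resonantSum v u (n + 1) l
      ≤ ∑ P : Fin (n + 1) → β × β, ∑ i, if ∑ i, pairMom v (P i) = 0 then
          g (P i) * pairWt u P else 0 := by
        refine Finset.sum_le_sum fun P _ => ?_
        by_cases hP : ∑ i, pairMom v (P i) = 0
        · simp only [if_pos hP, ← Finset.sum_mul]
          refine mul_le_mul_of_nonneg_right ?_ (pairWt_nonneg hu P)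
          exact (Finset.abs_sum_le_sum_abs _ _).trans (Finset.sum_le_sum fun i _ => habs _)
        · simp [if_neg hP]
    _ = ∑ i : Fin (n + 1), 2 * (u l * neighborSum v u n l) := by
        rw [Finset.sum_comm]
        exact Finset.sum_congr rfl fun i _ => (sum_resonant_eq v u n i g).trans hsum
    _ = _ := by
        simp
        ring

lemma neighborSum_le (v : β → ℤ) {u : β → ℝ} (hu : ∀ b, 0 ≤ u b) (n : ℕ) (l : β) :
    neighborSum v u n l ≤ (∑ b, u b - u l) * pairCount v u n 0 := by
  rw [← Finset.sum_erase_eq_sub (Finset.mem_univ l), Finset.sum_mul, neighborSum,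
    ← Finset.sum_filter, Finset.filter_ne']
  exact Finset.sum_le_sum fun b _ => mul_le_mul_of_nonneg_left (pairCount_le_zero v u n _) (hu b)

lemma sum_neighborSum_le {v : β → ℤ} (hv : Function.Injective v) {u : β → ℝ}
    (hu : ∀ b, 0 ≤ u b) (n : ℕ) :
    ∑ l, neighborSum v u n l ≤ (∑ b, u b) * (parabolaBound u n - pairCount v u n 0) := by
  simp only [neighborSum]
  rw [Finset.sum_comm, Finset.sum_mul]
  refine Finset.sum_le_sum fun b _ => ?_
  have h := sum_pairCount_pairMom_le hv hu n b
  rw [← Finset.add_sum_erase _ _ (Finset.mem_univ b), show pairMom v (b, b) = 0 by simp [pairMom]]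
    at h
  have e : ∑ l, (if b ≠ l then u b * pairCount v u n (pairMom v (b, l)) else 0) =
      u b * ∑ l ∈ Finset.univ.erase b, pairCount v u n (pairMom v (l, b)) := by
    rw [← Finset.sum_filter, Finset.filter_ne, Finset.mul_sum]
    simp only [pairCount_pairMom_comm v u n _ b]
  rw [e]
  exact mul_le_mul_of_nonneg_left (by linarith) (hu b)

lemma sqrt_mul_add_sqrt_mul_pow_four_le {h η F G Q ρ : ℝ} (hh : 0 ≤ h) (hη : 0 ≤ η) (hF : 0 ≤ F)
    (hG : 0 ≤ G) (hFQ : F ≤ η * Q) (hsum : F + G + (h + η) * Q ≤ (h + η) * ρ) :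
    (√(h * F) + √(η * G)) ^ 4 ≤ (h + η) * η * ((h + η) * ρ) ^ 2 := by
  rcases hη.eq_or_lt with rfl | hη
  · have : F = 0 := le_antisymm (by linarith) hF
    simp [this]
  have hS : 0 < h + η := by linarith
  have hX : (h + 2 * η) * F + η * G ≤ η * ((h + η) * ρ) := by
    nlinarith [mul_le_mul_of_nonneg_left hsum hη.le, mul_le_mul_of_nonneg_left hFQ hS.le]
  set X := (h + η) * ρ with hXdef
  have hX0 : 0 ≤ X := by
    have : 0 ≤ η * X := le_trans (by positivity) hX
    exact nonneg_of_mul_nonneg_right this hη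
  have hcs : (h + 2 * η) * (√(h * F) + √(η * G)) ^ 2 ≤ 2 * (h + η) * η * X := by
    have hCS : (√(h * F) + √(η * G)) ^ 2 ≤
        (h / (h + 2 * η) + 1) * ((h + 2 * η) * F + η * G) := by
      have h2 : 0 < h + 2 * η := by linarith
      have e1 := Real.sq_sqrt (mul_nonneg hh hF)
      have e2 := Real.sq_sqrt (mul_nonneg hη.le hG)
      have e3 : (h / (h + 2 * η) + 1) * ((h + 2 * η) * F + η * G) =
        h * F + η * G + (h / (h + 2 * η) * (η * G) + (h + 2 * η) * F) := by
        field_simp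
        ring
      have h4 : 2 * (√(h * F) * √(η * G)) ≤ h / (h + 2 * η) * (η * G) + (h + 2 * η) * F := by
        rw [← Real.sqrt_mul (by positivity)]
        have : h * F * (η * G) = (h / (h + 2 * η) * (η * G)) * ((h + 2 * η) * F) := by
          field_simp
        rw [this, Real.sqrt_mul (by positivity)]
        have f1 := Real.sq_sqrt (show 0 ≤ h / (h + 2 * η) * (η * G) by positivity)
        have f2 := Real.sq_sqrt (show 0 ≤ (h + 2 * η) * F by positivity)
        nlinarith [sq_nonneg (√(h / (h + 2 * η) * (η * G)) - √((h + 2 * η) * F))]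
      nlinarith
    have h2 : 0 < h + 2 * η := by linarith
    calc (h + 2 * η) * (√(h * F) + √(η * G)) ^ 2
        ≤ (h + 2 * η) * ((h / (h + 2 * η) + 1) * ((h + 2 * η) * F + η * G)) := by gcongr
      _ = (2 * h + 2 * η) * ((h + 2 * η) * F + η * G) := by
          field_simp
          ring
      _ ≤ (2 * h + 2 * η) * (η * X) := by gcongr
      _ = _ := by ring
  have h2 : 0 < h + 2 * η := by linarith
  refine le_of_mul_le_mul_left ?_ (pow_pos h2 2)
  calc (h + 2 * η) ^ 2 * (√(h * F) + √(η * G)) ^ 4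
      = ((h + 2 * η) * (√(h * F) + √(η * G)) ^ 2) ^ 2 := by ring
    _ ≤ (2 * (h + η) * η * X) ^ 2 := by gcongr
    _ = 4 * (h + η) * η * ((h + η) * η * X ^ 2) := by ring
    _ ≤ (h + 2 * η) ^ 2 * ((h + η) * η * X ^ 2) := by
        gcongr
        nlinarith [sq_nonneg h]
    _ = _ := by ring

lemma sum_sqrt_neighborSum_pow_four_le {v : β → ℤ} (hv : Function.Injective v) {u : β → ℝ}
    (hu : ∀ b, 0 ≤ u b) (n : ℕ) :
    (∑ l, √(u l * neighborSum v u n l)) ^ 4 * (n + 1) ≤ 8 / 3 * (∑ b, u b) ^ (4 * (n + 1)) := by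
  rcases isEmpty_or_nonempty β with hβ | hβ
  · simp
  obtain ⟨k, -, hk⟩ := Finset.exists_max_image Finset.univ u Finset.univ_nonempty
  set S := ∑ b, u b with hS
  have hηeq : ∑ b ∈ Finset.univ.erase k, u b = S - u k :=
    Finset.sum_erase_eq_sub (Finset.mem_univ k)
  set η := S - u k with hη
  have hη0 : 0 ≤ η := hηeq ▸ Finset.sum_nonneg fun b _ => hu b
  have hS0 : 0 ≤ S := Finset.sum_nonneg fun b _ => hu b
  set F := neighborSum v u n with hF
  have hF0 : ∀ l, 0 ≤ F l := neighborSum_nonneg v hu n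
  set G := ∑ l ∈ Finset.univ.erase k, F l with hG
  have hG0 : 0 ≤ G := Finset.sum_nonneg fun l _ => hF0 l
  have hSk : u k + η = S := by rw [hη]; ring
  have h1 : ∑ l, √(u l * F l) ≤ √(u k * F k) + √(η * G) := by
    rw [← Finset.add_sum_erase _ _ (Finset.mem_univ k)]
    gcongr
    refine Real.le_sqrt_of_sq_le ?_
    rw [← hηeq]
    exact Finset.sum_sq_le_sum_mul_sum_of_sq_le_mul _ (fun l _ => hu l) (fun l _ => hF0 l)
      fun l _ => (Real.sq_sqrt (mul_nonneg (hu l) (hF0 l))).le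
  have h2 := sqrt_mul_add_sqrt_mul_pow_four_le (hu k) hη0 (hF0 k) hG0
    (neighborSum_le v hu n k) (ρ := parabolaBound u n) (by
      have := sum_neighborSum_le hv hu n
      rw [← Finset.add_sum_erase _ _ (Finset.mem_univ k)] at this
      rw [hSk]
      linarith)
  rw [hSk] at h2
  have h3 : S * η ≤ ∑ p : β × β, if p.1 ≠ p.2 then u p.1 * u p.2 else 0 := by
    rw [Fintype.sum_prod_type, hS, Finset.sum_mul]
    refine Finset.sum_le_sum fun a _ => ?_
    rw [← Finset.sum_filter, Finset.filter_ne]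
    change u a * η ≤ ∑ b ∈ Finset.univ.erase a, u a * u b
    rw [← Finset.mul_sum, Finset.sum_erase_eq_sub (Finset.mem_univ a)]
    exact mul_le_mul_of_nonneg_left (sub_le_sub_left (hk a (Finset.mem_univ a)) _) (hu a)
  have h4 := parabolaBound_sq_mul_le hu n
  calc (∑ l, √(u l * F l)) ^ 4 * (n + 1)
      ≤ (√(u k * F k) + √(η * G)) ^ 4 * (n + 1) := by
        have : 0 ≤ ∑ l, √(u l * F l) := Finset.sum_nonneg fun l _ => Real.sqrt_nonneg _
        gcongr
    _ ≤ S * η * (S * parabolaBound u n) ^ 2 * (n + 1) := by gcongr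
    _ = S ^ 2 * (parabolaBound u n ^ 2 * ((n + 1) * (S * η))) := by ring
    _ ≤ S ^ 2 * (8 / 3 * S ^ (2 * n) * S ^ (2 * (n + 1))) := by
        refine mul_le_mul_of_nonneg_left (le_trans ?_ h4) (by positivity)
        gcongr
    _ = 8 / 3 * S ^ (4 * (n + 1)) := by ring

lemma sum_sqrt_centralBinom_mul_resonantSum_le {v : β → ℤ} (hv : Function.Injective v)
    {u : β → ℝ} (hu : ∀ b, 0 ≤ u b) (n : ℕ) :
    ∑ l, √((n + 1).centralBinom * resonantSum v u (n + 1) l) ≤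
      √2 * (2 * ∑ b, u b) ^ (n + 1) := by
  set C : ℝ := ((n + 1).centralBinom : ℝ) with hC
  set S := ∑ b, u b with hS
  have hS0 : 0 ≤ S := Finset.sum_nonneg fun b _ => hu b
  have h1 : ∑ l, √(C * resonantSum v u (n + 1) l) ≤
      √(C * (2 * (n + 1))) * ∑ l, √(u l * neighborSum v u n l) := by
    rw [Finset.mul_sum]
    refine Finset.sum_le_sum fun l _ => ?_
    rw [← Real.sqrt_mul (by positivity)]
    refine Real.sqrt_le_sqrt ?_
    rw [mul_assoc]
    exact mul_le_mul_of_nonneg_left (resonantSum_le v hu n l) (by positivity)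
  have h2 := sum_sqrt_neighborSum_pow_four_le hv hu n
  have h3 : C ^ 2 * (3 * (n + 1) + 1) ≤ 16 ^ (n + 1) := by
    rw [hC]
    exact_mod_cast centralBinom_sq_mul_le (n + 1)
  refine h1.trans ?_
  set A := ∑ l, √(u l * neighborSum v u n l) with hA
  have hA0 : 0 ≤ A := Finset.sum_nonneg fun l _ => Real.sqrt_nonneg _
  refine le_of_pow_le_pow_left₀ (n := 4) (by norm_num) (by positivity) ?_
  have e1 : √(C * (2 * (n + 1))) ^ 4 = (C * (2 * (n + 1))) ^ 2 := by
    rw [show 4 = 2 * 2 by norm_num, pow_mul, Real.sq_sqrt (by positivity)]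
  have e2 : √2 ^ 4 = (4 : ℝ) := by
    rw [show 4 = 2 * 2 by norm_num, pow_mul, Real.sq_sqrt (by positivity)]
    norm_num
  rw [mul_pow, mul_pow, e1, e2]
  calc (C * (2 * (n + 1))) ^ 2 * A ^ 4 = 4 * C ^ 2 * (n + 1) * (A ^ 4 * (n + 1)) := by ring
    _ ≤ 4 * C ^ 2 * (n + 1) * (8 / 3 * S ^ (4 * (n + 1))) := by gcongr
    _ = 32 / 9 * (C ^ 2 * (3 * (n + 1))) * S ^ (4 * (n + 1)) := by ring
    _ ≤ 32 / 9 * 16 ^ (n + 1) * S ^ (4 * (n + 1)) := by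
        gcongr
        refine le_trans ?_ h3
        gcongr
        linarith
    _ ≤ 4 * 16 ^ (n + 1) * S ^ (4 * (n + 1)) := by
        gcongr
        norm_num
    _ = 4 * ((2 * S) ^ (n + 1)) ^ 4 := by
        rw [← pow_mul, mul_comm (n + 1) 4, mul_pow, pow_mul 2 4]
        norm_num
        ring

end Core

lemma rpow_add_le_add_mul_rpow {θ x y : ℝ} (h0 : 0 ≤ θ) (h1 : θ ≤ 1) (hx : 0 ≤ x) (hxy : x ≤ y) :
    (y + x) ^ θ ≤ y ^ θ + θ * x ^ θ := by
  rcases (hx.trans hxy).eq_or_lt with rfl | hy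
  · obtain rfl : x = 0 := le_antisymm hxy hx
    simpa using mul_nonneg h0 (Real.rpow_nonneg le_rfl θ)
  have hd : 0 ≤ x / y := by positivity
  have hb := rpow_one_add_le_one_add_mul_self (s := x / y) (by linarith) h0 h1
  have hp : x / y ≤ (x / y) ^ θ :=
    Real.self_le_rpow_of_le_one hd ((div_le_one hy).2 hxy) h1
  have e1 : (y + x) ^ θ = y ^ θ * (1 + x / y) ^ θ := by
    rw [← Real.mul_rpow hy.le (by positivity)]
    congr 1
    field_simp
  have e2 : x ^ θ = y ^ θ * (x / y) ^ θ := by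
    rw [← Real.mul_rpow hy.le hd]
    congr 1
    field_simp
  rw [e1, e2]
  have hyθ : 0 ≤ y ^ θ := by positivity
  nlinarith [mul_le_mul_of_nonneg_left hb hyθ,
    mul_le_mul_of_nonneg_left (mul_le_mul_of_nonneg_left hp h0) hyθ]

lemma rpow_sum_le_rpow_max_add {ι : Type*} {θ : ℝ} (h0 : 0 ≤ θ) (h1 : θ ≤ 1) {y : ℝ} {x : ι → ℝ}
    (s : Finset ι) (hx : ∀ i ∈ s, 0 ≤ x i ∧ x i ≤ y) :
    (y + ∑ i ∈ s, x i) ^ θ ≤ y ^ θ + θ * ∑ i ∈ s, x i ^ θ := by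
  induction s using Finset.induction_on with
  | empty => simp
  | insert a s ha ih =>
    have ha' := hx a (Finset.mem_insert_self a s)
    have hs : ∀ i ∈ s, 0 ≤ x i ∧ x i ≤ y := fun i hi => hx i (Finset.mem_insert_of_mem hi)
    have hsum : 0 ≤ ∑ i ∈ s, x i := Finset.sum_nonneg fun i hi => (hs i hi).1
    rw [Finset.sum_insert ha, Finset.sum_insert ha, add_comm (x a), ← add_assoc]
    have := rpow_add_le_add_mul_rpow h0 h1 ha'.1 (ha'.2.trans (le_add_of_nonneg_right hsum))
    linarith [ih hs]

/-- The difference of the numbers of occurrences of `(1, l)` and `(-1, l)` in `j`. -/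
def unbalance {n : ℕ} (j : Fin n → ℤ × ℤ) (l : ℤ) : ℤ :=
  ∑ i, (j i).1 * if (j i).2 = l then 1 else 0

lemma exists_le_abs_of_unbalance_ne_zero {m : ℕ} (hm : 2 ≤ m) {N : ℝ} (hN : 1 ≤ N)
    {j : Fin (2 * m) → ℤ × ℤ} (hj : inR j) {l : ℤ} (hl : (m : ℝ) * N ^ 2 ≤ |(l : ℝ)|)
    (hd : unbalance j l ≠ 0) {α β : Fin (2 * m)} (hα : (j α).2 = l) (hβ : β ≠ α) :
    ∃ γ ∈ (Finset.univ.erase α).erase β, N ≤ |((j γ).2 : ℝ)| := by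
  by_contra! hlt
  obtain ⟨⟨hU, -, hmom⟩, hen⟩ := hj
  have hm' : (2 : ℝ) ≤ m := by exact_mod_cast hm
  have hβ' : β ∈ Finset.univ.erase α := by simp [hβ]
  set R := (Finset.univ.erase α).erase β with hR
  have hcard : (R.card : ℝ) = 2 * m - 2 := by
    rw [hR, Finset.card_erase_of_mem hβ', Finset.card_erase_of_mem (Finset.mem_univ α),
      Finset.card_univ, Fintype.card_fin, Nat.sub_sub, Nat.cast_sub (by omega)]
    push_cast
    ring
  have split : ∀ f : Fin (2 * m) → ℤ, ∑ i, f i = f α + (f β + ∑ i ∈ R, f i) := fun f => by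
    rw [Finset.add_sum_erase _ _ hβ', Finset.add_sum_erase _ _ (Finset.mem_univ α)]
  have habs : ∀ (f : Fin (2 * m) → ℤ) (c : ℝ), (∀ i ∈ R, |((f i : ℤ) : ℝ)| ≤ c) →
      |((∑ i ∈ R, f i : ℤ) : ℝ)| ≤ (2 * m - 2) * c := by
    intro f c hf
    rw [Int.cast_sum, ← hcard, ← nsmul_eq_mul]
    exact (Finset.abs_sum_le_sum_abs _ _).trans (Finset.sum_le_card_nsmul _ _ _ hf)
  have hδ : ∀ i, |((j i).1 : ℝ)| = 1 := fun i => by rcases hU i with h | h <;> simp [h]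
  have hNl : N < |(l : ℝ)| := by nlinarith
  have hRl : ∀ i ∈ R, (j i).2 ≠ l := fun i hi h => by
    have := hlt i hi
    rw [h] at this
    linarith
  have hE := habs (fun i => (j i).1 * (j i).2 ^ 2) (N ^ 2) fun i hi => by
    push_cast
    rw [abs_mul, hδ, one_mul, abs_pow]
    exact pow_le_pow_left₀ (abs_nonneg _) (hlt i hi).le 2
  have hM := habs (fun i => (j i).1 * (j i).2) N fun i hi => by
    push_cast
    rw [abs_mul, hδ, one_mul]
    exact (hlt i hi).le
  rw [split] at hmom hen
  rw [unbalance, split, Finset.sum_eq_zero (fun i hi => by simp [hRl i hi]), hα, if_pos rfl,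
    add_zero, mul_one] at hd
  rw [show ∑ i ∈ R, (j i).1 * (j i).2 ^ 2 = -((j α).1 * l ^ 2 + (j β).1 * (j β).2 ^ 2) by
    rw [hα] at hen; linarith] at hE
  rw [show ∑ i ∈ R, (j i).1 * (j i).2 = -((j α).1 * l + (j β).1 * (j β).2) by
    rw [hα] at hmom; linarith] at hM
  set b := (j β).2
  have hl2 : (m : ℝ) ^ 2 * N ^ 2 ≤ (l : ℝ) ^ 2 := by
    rw [← sq_abs (l : ℝ), ← mul_pow]
    exact pow_le_pow_left₀ (by positivity) (by nlinarith) 2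
  have hN2 : 1 ≤ N ^ 2 := one_le_pow₀ hN
  by_cases hs : (j β).1 = (j α).1
  · have hE' : (l : ℝ) ^ 2 + (b : ℝ) ^ 2 ≤ (2 * m - 2) * N ^ 2 := by
      rw [hs, ← mul_add, Int.cast_neg, Int.cast_mul, abs_neg, abs_mul, hδ, one_mul] at hE
      push_cast at hE
      exact (le_abs_self _).trans hE
    nlinarith [sq_nonneg (b : ℝ), sq_nonneg ((m : ℝ) - 1)]
  · have hs' : (j β).1 = -(j α).1 := by
      rcases hU α with h | h <;> rcases hU β with h' | h' <;> omega
    rw [hs'] at hE hM hd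
    have hbl : b ≠ l := fun h => hd (by simp [h])
    have hE' : |(l : ℝ) - b| * |(l : ℝ) + b| ≤ (2 * m - 2) * N ^ 2 := by
      rw [show (j α).1 * l ^ 2 + -(j α).1 * b ^ 2 = (j α).1 * ((l - b) * (l + b)) by ring,
        Int.cast_neg, Int.cast_mul, abs_neg, abs_mul, hδ, one_mul] at hE
      push_cast at hE
      rwa [abs_mul] at hE
    have hM' : |(l : ℝ) - b| ≤ (2 * m - 2) * N := by
      rw [show (j α).1 * l + -(j α).1 * b = (j α).1 * (l - b) by ring,
        Int.cast_neg, Int.cast_mul, abs_neg, abs_mul, hδ, one_mul] at hM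
      push_cast at hM
      exact hM
    have htri : 2 * |(l : ℝ)| ≤ |(l : ℝ) - b| + |(l : ℝ) + b| := by
      have := abs_add_le ((l : ℝ) - b) (l + b)
      rw [show (l : ℝ) - b + (l + b) = 2 * l by ring, abs_mul] at this
      simpa using this
    have hx : 1 ≤ |(l : ℝ) - b| := by
      have : 1 ≤ |l - b| := Int.one_le_abs (sub_ne_zero.2 hbl.symm)
      exact_mod_cast this
    by_cases hy : l + b = 0
    · have hy' : (l : ℝ) + b = 0 := by exact_mod_cast hy
      rw [hy', abs_zero, add_zero] at htri
      nlinarith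
    · have hy' : 1 ≤ |(l : ℝ) + b| := by
        have : 1 ≤ |l + b| := Int.one_le_abs hy
        exact_mod_cast this
      nlinarith [mul_nonneg (sub_nonneg.2 hx) (sub_nonneg.2 hy')]

lemma two_mul_rpow_abs_add_le {θ : ℝ} (hθ : θ ∈ Set.Ioo (0 : ℝ) 1) {m : ℕ} (hm : 2 ≤ m) {N : ℝ}
    (hN : 1 ≤ N) {j : Fin (2 * m) → ℤ × ℤ} (hj : inR j) {l : ℤ}
    (hl : (m : ℝ) * N ^ 2 ≤ |(l : ℝ)|) (hd : unbalance j l ≠ 0) :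
    2 * |(l : ℝ)| ^ θ + (1 - θ) * N ^ θ ≤ ∑ i, |((j i).2 : ℝ)| ^ θ := by
  obtain ⟨h0, h1⟩ := hθ
  obtain ⟨α, hα⟩ : ∃ α, (j α).2 = l := by
    by_contra! h
    exact hd (Finset.sum_eq_zero fun i _ => by simp [h i])
  have hne : (Finset.univ.erase α).Nonempty := by
    rw [← Finset.card_pos, Finset.card_erase_of_mem (Finset.mem_univ α), Finset.card_univ,
      Fintype.card_fin]
    omega
  obtain ⟨β, hβ, hmax⟩ := Finset.exists_max_image (Finset.univ.erase α)
    (fun i => |((j i).2 : ℝ)|) hne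
  obtain ⟨γ, hγ, hNγ⟩ := exists_le_abs_of_unbalance_ne_zero hm hN hj hl hd hα
    (Finset.ne_of_mem_erase hβ)
  have hmom : |(l : ℝ)| ≤ ∑ i ∈ Finset.univ.erase α, |((j i).2 : ℝ)| := by
    have hδ : ∀ i, |((j i).1 : ℝ)| = 1 := fun i => by rcases hj.1.1 i with h | h <;> simp [h]
    have h := hj.1.2.2
    rw [← Finset.add_sum_erase _ _ (Finset.mem_univ α), hα] at h
    have h' : ((j α).1 : ℝ) * l = -∑ i ∈ Finset.univ.erase α, ((j i).1 : ℝ) * (j i).2 := by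
      rw [eq_neg_iff_add_eq_zero]
      exact_mod_cast h
    calc |(l : ℝ)| = |((j α).1 : ℝ) * l| := by rw [abs_mul, hδ, one_mul]
      _ ≤ ∑ i ∈ Finset.univ.erase α, |((j i).1 : ℝ) * (j i).2| := by
        rw [h', abs_neg]
        exact Finset.abs_sum_le_sum_abs _ _
      _ = _ := Finset.sum_congr rfl fun i _ => by rw [abs_mul, hδ, one_mul]
  rw [← Finset.add_sum_erase _ _ hβ] at hmom
  have hpow := (Real.rpow_le_rpow (abs_nonneg _) hmom h0.le).trans
    (rpow_sum_le_rpow_max_add h0.le h1.le (y := |((j β).2 : ℝ)|) _ fun i hi =>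
      ⟨abs_nonneg _, hmax i (Finset.mem_of_mem_erase hi)⟩)
  rw [← Finset.add_sum_erase _ _ (Finset.mem_univ α), ← Finset.add_sum_erase _ _ hβ, hα]
  have hNle : N ^ θ ≤ ∑ i ∈ (Finset.univ.erase α).erase β, |((j i).2 : ℝ)| ^ θ :=
    (Real.rpow_le_rpow (by linarith) hNγ h0.le).trans
      (Finset.single_le_sum (f := fun i => |((j i).2 : ℝ)| ^ θ)
        (fun i _ => Real.rpow_nonneg (abs_nonneg _) θ) hγ)
  nlinarith [mul_le_mul_of_nonneg_left hNle (sub_nonneg.2 h1.le)]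

lemma wt_sq_le {σ θ : ℝ} (hσ : 0 < σ) (hθ : θ ∈ Set.Ioo (0 : ℝ) 1) {m : ℕ} (hm : 2 ≤ m) {N : ℝ}
    (hN : 1 ≤ N) {j : Fin (2 * m) → ℤ × ℤ} (hj : inR j) {l : ℤ}
    (hl : (m : ℝ) * N ^ 2 ≤ |(l : ℝ)|) (hd : unbalance j l ≠ 0) :
    wt σ θ l ^ 2 ≤ Real.exp (-(σ * (1 - θ) * N ^ θ)) * ∏ i, wt σ θ (j i).2 := by
  simp only [wt]
  rw [← Real.exp_sum, ← Real.exp_add, ← Real.exp_nat_mul, Real.exp_le_exp, ← Finset.mul_sum]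
  have := mul_le_mul_of_nonneg_left (two_mul_rpow_abs_add_le hθ hm hN hj hl hd) hσ.le
  push_cast
  linarith

/-- The multi-index with modes `a` whose entries of sign `1` are those in `s`. -/
def signedIndex {n : ℕ} (s : Finset (Fin n)) (a : Fin n → ℤ) : Fin n → ℤ × ℤ :=
  fun i => (if i ∈ s then 1 else -1, a i)

lemma sum_sign_mul_eq {m : ℕ} (s : Finset (Fin (2 * m))) (e : Fin m ⊕ Fin m ≃ Fin (2 * m))
    (hl : ∀ i, e (Sum.inl i) ∈ s) (hr : ∀ i, e (Sum.inr i) ∉ s) (f : Fin (2 * m) → ℤ) :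
    ∑ k, (if k ∈ s then 1 else -1) * f k = ∑ i, (f (e (Sum.inl i)) - f (e (Sum.inr i))) := by
  rw [← e.sum_comp, Fintype.sum_sum_type, Finset.sum_sub_distrib, sub_eq_add_neg]
  simp [hl, hr]

lemma sum_unbalance_signedIndex_le (B : Finset ℤ) {u : ℤ → ℝ} (hu : ∀ a, 0 ≤ u a) {m : ℕ}
    {s : Finset (Fin (2 * m))} (hs : s.card = m) (l : B) :
    ∑ a : Fin (2 * m) → B, (if inR (signedIndex s fun i => (a i : ℤ)) then
      |(unbalance (signedIndex s fun i => (a i : ℤ)) l : ℝ)| * ∏ i, u (a i) else 0) ≤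
      resonantSum (Subtype.val : B → ℤ) (fun b : B => u b) m l := by
  have hs' : sᶜ.card = m := by
    rw [Finset.card_compl, Fintype.card_fin, hs]
    omega
  let e : Fin m ⊕ Fin m ≃ Fin (2 * m) := finSumEquivOfFinset hs hs'
  have hl : ∀ i, e (Sum.inl i) ∈ s := fun i => by
    simp only [e, finSumEquivOfFinset_inl]
    exact Finset.orderEmbOfFin_mem s hs i
  have hr : ∀ i, e (Sum.inr i) ∉ s := fun i => by
    simp only [e, finSumEquivOfFinset_inr]
    exact Finset.mem_compl.1 (Finset.orderEmbOfFin_mem sᶜ hs' i)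
  let E : (Fin (2 * m) → B) ≃ (Fin m → B × B) :=
    ((e.symm.arrowCongr (Equiv.refl B)).trans (Equiv.sumArrowEquivProdArrow _ _ _)).trans
      (Equiv.arrowProdEquivProdArrow (Fin m) (fun _ => B) (fun _ => B)).symm
  have hE : ∀ a i, E a i = (a (e (Sum.inl i)), a (e (Sum.inr i))) := fun a i => rfl
  rw [resonantSum, ← E.sum_comp]
  refine Finset.sum_le_sum fun a _ => ?_
  have hwt : ∏ i, u (a i) = pairWt (fun b : B => u b) (E a) := by
    rw [← e.prod_comp, Fintype.prod_sum_type, pairWt, Finset.prod_mul_distrib]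
    rfl
  have hW := pairWt_nonneg (u := fun b : B => u b) (fun b => hu b) (E a)
  by_cases hR : inR (signedIndex s fun i => (a i : ℤ))
  · have hen := hR.2
    have hmom := hR.1.2.2
    simp only [signedIndex] at hen hmom
    rw [sum_sign_mul_eq s e hl hr] at hen hmom
    have h0 : ∑ i, pairMom (Subtype.val : B → ℤ) (E a i) = 0 := by
      ext
      · simpa [pairMom, hE, Prod.fst_sum] using hmom
      · simpa [pairMom, hE, Prod.snd_sum] using hen
    rw [if_pos hR, if_pos h0, hwt]
    refine mul_le_mul_of_nonneg_right (le_of_eq ?_) hW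
    simp only [unbalance, signedIndex]
    rw [sum_sign_mul_eq s e hl hr]
    simp only [hE, Subtype.ext_iff]
    push_cast
    refine congrArg _ (Finset.sum_congr rfl fun i _ => ?_)
    by_cases h₁ : (a (e (Sum.inl i)) : ℤ) = l <;> by_cases h₂ : (a (e (Sum.inr i)) : ℤ) = l <;>
      simp [h₁, h₂]
  · rw [if_neg hR]
    split_ifs
    · exact mul_nonneg (abs_nonneg _) hW
    · exact le_rfl

lemma sum_unbalance_le (B : Finset ℤ) {u : ℤ → ℝ} (hu : ∀ a, 0 ≤ u a) {m : ℕ}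
    (J : Finset (Fin (2 * m) → ℤ × ℤ)) (hJ : ∀ j ∈ J, inR j) (hB : ∀ j ∈ J, ∀ i, (j i).2 ∈ B)
    (l : B) :
    ∑ j ∈ J, |(unbalance j l : ℝ)| * ∏ i, u (j i).2 ≤
      m.centralBinom * resonantSum (Subtype.val : B → ℤ) (fun b : B => u b) m l := by
  set F : (Fin (2 * m) → ℤ × ℤ) → ℝ := fun j =>
    if inR j then |(unbalance j l : ℝ)| * ∏ i, u (j i).2 else 0 with hF
  have hF0 : ∀ j, 0 ≤ F j := fun j => by
    simp only [hF]
    split_ifs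
    · exact mul_nonneg (abs_nonneg _) (Finset.prod_nonneg fun i _ => hu _)
    · exact le_rfl
  set D := Finset.powersetCard m (Finset.univ : Finset (Fin (2 * m))) ×ˢ
    (Finset.univ : Finset (Fin (2 * m) → B)) with hD
  set ψ : Finset (Fin (2 * m)) × (Fin (2 * m) → B) → Fin (2 * m) → ℤ × ℤ :=
    fun p => signedIndex p.1 fun i => (p.2 i : ℤ) with hψ
  have hsub : J ⊆ D.image ψ := by
    intro j hj
    obtain ⟨⟨hU, hsum, -⟩, -⟩ := hJ j hj
    have hsign : ∀ i, (if i ∈ Finset.univ.filter fun i => (j i).1 = 1 then (1 : ℤ) else -1) =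
        (j i).1 := fun i => by
      rcases hU i with h | h <;> simp [h]
    refine Finset.mem_image.2 ⟨(Finset.univ.filter fun i => (j i).1 = 1,
      fun i => ⟨(j i).2, hB j hj i⟩), ?_, ?_⟩
    · rw [hD, Finset.mem_product, Finset.mem_powersetCard]
      refine ⟨⟨Finset.subset_univ _, ?_⟩, Finset.mem_univ _⟩
      change (Finset.univ.filter fun i => (j i).1 = 1).card = m
      have h : ∀ i, (j i).1 = 2 * (if (j i).1 = 1 then 1 else 0) - 1 := fun i => by
        rcases hU i with h | h <;> simp [h]
      rw [Finset.sum_congr rfl fun i _ => h i, Finset.sum_sub_distrib, ← Finset.mul_sum,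
        Finset.sum_boole, Finset.sum_const, Finset.card_univ, Fintype.card_fin] at hsum
      simp only [nsmul_eq_mul, mul_one, Nat.cast_mul, Nat.cast_ofNat] at hsum
      omega
    · funext i
      simp only [hψ, signedIndex, hsign]
  calc ∑ j ∈ J, |(unbalance j l : ℝ)| * ∏ i, u (j i).2 = ∑ j ∈ J, F j :=
        Finset.sum_congr rfl fun j hj => (if_pos (hJ j hj)).symm
    _ ≤ ∑ j ∈ D.image ψ, F j :=
        Finset.sum_le_sum_of_subset_of_nonneg hsub fun j _ _ => hF0 j
    _ ≤ ∑ p ∈ D, F (ψ p) := Finset.sum_image_le_of_nonneg fun j _ => hF0 j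
    _ = ∑ s ∈ Finset.powersetCard m (Finset.univ : Finset (Fin (2 * m))),
          ∑ a : Fin (2 * m) → B, F (ψ (s, a)) := Finset.sum_product _ _ _
    _ ≤ ∑ s ∈ Finset.powersetCard m (Finset.univ : Finset (Fin (2 * m))),
          resonantSum (Subtype.val : B → ℤ) (fun b : B => u b) m l :=
        Finset.sum_le_sum fun s hs =>
          sum_unbalance_signedIndex_le B hu (Finset.mem_powersetCard.1 hs).2 l
    _ = _ := by
        rw [Finset.sum_const, Finset.card_powersetCard, Finset.card_univ, Fintype.card_fin,
          nsmul_eq_mul, Nat.centralBinom_eq_two_mul_choose]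

/-- The contribution of the multi-index `j` to the series `actionBracket K l z`. -/
def bracketTerm {n : ℕ} (K : (Fin n → ℤ × ℤ) → ℂ) (z : ℤ → ℂ) (l : ℤ)
    (j : Fin n → ℤ × ℤ) : ℂ :=
  K j * (Complex.I *
    (((Finset.univ.filter fun α => j α = ((-1 : ℤ), l)).card : ℂ) -
      ((Finset.univ.filter fun α => j α = ((1 : ℤ), l)).card : ℂ))) * zProd z j

lemma card_sub_card_eq_neg_unbalance {n : ℕ} {j : Fin n → ℤ × ℤ} (hj : isU2 j) (l : ℤ) :
    ((Finset.univ.filter fun α => j α = ((-1 : ℤ), l)).card : ℤ) -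
      ((Finset.univ.filter fun α => j α = ((1 : ℤ), l)).card : ℤ) = -unbalance j l := by
  rw [Finset.card_filter, Finset.card_filter, unbalance, ← Finset.sum_neg_distrib]
  push_cast
  rw [← Finset.sum_sub_distrib]
  refine Finset.sum_congr rfl fun i _ => ?_
  by_cases h : (j i).2 = l <;> rcases hj i with h' | h' <;> simp [Prod.ext_iff, h, h']

lemma norm_zProd {n : ℕ} (z : ℤ → ℂ) (j : Fin n → ℤ × ℤ) :
    ‖zProd z j‖ = ∏ i, ‖z (j i).2‖ := by
  rw [zProd, norm_prod]
  refine Finset.prod_congr rfl fun i _ => ?_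
  rw [idxVal]
  split_ifs
  · rfl
  · exact Complex.norm_conj _

lemma norm_bracketTerm_le {n : ℕ} {K : (Fin n → ℤ × ℤ) → ℂ} (hK : inHR K) (z : ℤ → ℂ) (l : ℤ)
    {j : Fin n → ℤ × ℤ} (hj : inR j) :
    ‖bracketTerm K z l j‖ ≤ supNorm K * (|(unbalance j l : ℝ)| * ∏ i, ‖z (j i).2‖) := by
  have h := congrArg (Int.cast : ℤ → ℂ) (card_sub_card_eq_neg_unbalance hj.1.1 l)
  push_cast at h
  rw [bracketTerm, h, norm_mul, norm_mul, norm_mul, Complex.norm_I, one_mul, norm_neg, mul_assoc,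
    norm_zProd, Complex.norm_intCast]
  exact mul_le_mul_of_nonneg_right (le_ciSup hK.2.2.1 j)
    (mul_nonneg (abs_nonneg _) (Finset.prod_nonneg fun _ _ => norm_nonneg _))

lemma bracketTerm_eq_zero {n : ℕ} {K : (Fin n → ℤ × ℤ) → ℂ} (hK : inHR K) (z : ℤ → ℂ) (l : ℤ)
    {j : Fin n → ℤ × ℤ} (hj : ¬ inR j) : bracketTerm K z l j = 0 := by
  rw [bracketTerm, not_not.1 fun h => hj (hK.2.2.2 j h), zero_mul, zero_mul]

lemma supNorm_nonneg {n : ℕ} (K : (Fin n → ℤ × ℤ) → ℂ) : 0 ≤ supNorm K :=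
  Real.iSup_nonneg fun _ => norm_nonneg _

lemma wt_sq_mul_norm_bracketTerm_le {σ θ : ℝ} (hσ : 0 < σ) (hθ : θ ∈ Set.Ioo (0 : ℝ) 1) {m : ℕ}
    (hm : 2 ≤ m) {K : (Fin (2 * m) → ℤ × ℤ) → ℂ} (hK : inHR K) (z : ℤ → ℂ) {N : ℝ} (hN : 1 ≤ N)
    {l : ℤ} (hl : (m : ℝ) * N ^ 2 ≤ |(l : ℝ)|) {j : Fin (2 * m) → ℤ × ℤ} (hj : inR j) :
    wt σ θ l ^ 2 * ‖bracketTerm K z l j‖ ≤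
      supNorm K * Real.exp (-(σ * (1 - θ) * N ^ θ)) *
        (|(unbalance j l : ℝ)| * ∏ i, (wt σ θ (j i).2 * ‖z (j i).2‖)) := by
  have h := norm_bracketTerm_le hK z l hj
  by_cases hd : unbalance j l = 0
  · have h0 : ‖bracketTerm K z l j‖ = 0 := le_antisymm (by simpa [hd] using h) (norm_nonneg _)
    simp [h0, hd]
  · have hR := mul_nonneg (supNorm_nonneg K) (mul_nonneg (abs_nonneg (unbalance j l : ℝ))
      (Finset.prod_nonneg (s := Finset.univ) fun i _ => norm_nonneg (z (j i).2)))
    calc wt σ θ l ^ 2 * ‖bracketTerm K z l j‖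
        ≤ (Real.exp (-(σ * (1 - θ) * N ^ θ)) * ∏ i, wt σ θ (j i).2) *
          (supNorm K * (|(unbalance j l : ℝ)| * ∏ i, ‖z (j i).2‖)) :=
          mul_le_mul (wt_sq_le hσ hθ hm hN hj hl hd) h (norm_nonneg _)
            (mul_nonneg (Real.exp_pos _).le (Finset.prod_nonneg fun _ _ => (Real.exp_pos _).le))
      _ = _ := by
          rw [Finset.prod_mul_distrib]
          ring

lemma sum_wt_mul_sqrt_sum_bracketTerm_le {σ θ : ℝ} (hσ : 0 < σ) (hθ : θ ∈ Set.Ioo (0 : ℝ) 1)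
    {m : ℕ} (hm : 2 ≤ m) {K : (Fin (2 * m) → ℤ × ℤ) → ℂ} (hK : inHR K) {z : ℤ → ℂ}
    (hz : inG σ θ z) {N : ℝ} (hN : 1 ≤ N) {s : Finset ℤ}
    (hs : ∀ l ∈ s, (m : ℝ) * N ^ 2 ≤ |(l : ℝ)|) (J : Finset (Fin (2 * m) → ℤ × ℤ)) :
    ∑ l ∈ s, wt σ θ l * √(∑ j ∈ J, ‖bracketTerm K z l j‖) ≤
      √2 * √(supNorm K) * Real.exp (-(σ * (1 - θ) * N ^ θ) / 2) * gNorm σ θ z ^ m := by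
  set u : ℤ → ℝ := fun a => wt σ θ a * ‖z a‖ with hu_def
  have hu : ∀ a, 0 ≤ u a := fun a => mul_nonneg (Real.exp_pos _).le (norm_nonneg _)
  set J' := J.filter fun j => inR j with hJ'
  have hJR : ∀ j ∈ J', inR j := fun j hj => (Finset.mem_filter.1 hj).2
  set B : Finset ℤ := s ∪ J'.biUnion fun j => Finset.univ.image fun i => (j i).2 with hB
  have hJB : ∀ j ∈ J', ∀ i, (j i).2 ∈ B := fun j hj i =>
    Finset.mem_union_right _ (Finset.mem_biUnion.2
      ⟨j, hj, Finset.mem_image_of_mem _ (Finset.mem_univ i)⟩)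
  set E := Real.exp (-(σ * (1 - θ) * N ^ θ)) with hE
  set R : B → ℝ := fun b =>
    m.centralBinom * resonantSum (Subtype.val : B → ℤ) (fun b : B => u b) m b with hR
  have hc : 0 ≤ supNorm K * E := mul_nonneg (supNorm_nonneg K) (Real.exp_pos _).le
  have hterm : ∀ l (hl : l ∈ s), wt σ θ l * √(∑ j ∈ J, ‖bracketTerm K z l j‖) ≤
      √(supNorm K * E) * √(R ⟨l, Finset.mem_union_left _ hl⟩) := by
    intro l hl
    have hw : 0 ≤ wt σ θ l := (Real.exp_pos _).le
    rw [← Real.sqrt_sq hw, ← Real.sqrt_mul (sq_nonneg _),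
      ← Real.sqrt_mul hc]
    refine Real.sqrt_le_sqrt ?_
    have hfil : ∑ j ∈ J, ‖bracketTerm K z l j‖ = ∑ j ∈ J', ‖bracketTerm K z l j‖ := by
      refine (Finset.sum_filter_of_ne fun j _ hj => ?_).symm
      by_contra h
      exact hj (by rw [bracketTerm_eq_zero hK z l h, norm_zero])
    rw [hfil, Finset.mul_sum]
    calc ∑ j ∈ J', wt σ θ l ^ 2 * ‖bracketTerm K z l j‖
        ≤ ∑ j ∈ J', supNorm K * E * (|(unbalance j l : ℝ)| * ∏ i, u (j i).2) :=
          Finset.sum_le_sum fun j hj =>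
            wt_sq_mul_norm_bracketTerm_le hσ hθ hm hK z hN (hs l hl) (hJR j hj)
      _ = supNorm K * E * ∑ j ∈ J', |(unbalance j l : ℝ)| * ∏ i, u (j i).2 :=
          (Finset.mul_sum _ _ _).symm
      _ ≤ _ := mul_le_mul_of_nonneg_left
          (sum_unbalance_le B hu J' hJR hJB ⟨l, Finset.mem_union_left _ hl⟩) hc
  have hsB : ∑ l ∈ s, wt σ θ l * √(∑ j ∈ J, ‖bracketTerm K z l j‖) ≤
      ∑ b : B, √(supNorm K * E) * √(R b) := by
    rw [← Finset.sum_attach s]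
    refine (Finset.sum_le_sum fun (l : s) _ => hterm l l.2).trans ?_
    rw [← Finset.sum_image (f := fun b : B => √(supNorm K * E) * √(R b))
      (g := fun l : s => (⟨l, Finset.mem_union_left _ l.2⟩ : B))]
    · exact Finset.sum_le_sum_of_subset_of_nonneg (Finset.subset_univ _) fun b _ _ => by positivity
    · intro a _ b _ h
      exact Subtype.ext (congrArg (fun b : B => (b : ℤ)) h)
  obtain ⟨n, rfl⟩ : ∃ n, m = n + 1 := ⟨m - 1, by omega⟩
  have hmain : ∑ b : B, √(R b) ≤ √2 * gNorm σ θ z ^ (n + 1) := by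
    refine (sum_sqrt_centralBinom_mul_resonantSum_le Subtype.val_injective
      (fun b : B => hu b) n).trans ?_
    have hle : ∑ b : B, u b ≤ ∑' a, u a := by
      rw [Finset.sum_coe_sort B u]
      exact hz.sum_le_tsum _ fun a _ => hu a
    have h0 : 0 ≤ ∑ b : B, u b := Finset.sum_nonneg fun b _ => hu b
    rw [gNorm]
    gcongr
  have hsqrtE : √E = Real.exp (-(σ * (1 - θ) * N ^ θ) / 2) := by
    rw [hE, Real.exp_half]
  calc _ ≤ _ := hsB
    _ = √(supNorm K * E) * ∑ b : B, √(R b) := (Finset.mul_sum _ _ _).symm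
    _ ≤ √(supNorm K * E) * (√2 * gNorm σ θ z ^ (n + 1)) :=
        mul_le_mul_of_nonneg_left hmain (Real.sqrt_nonneg _)
    _ = _ := by
        rw [Real.sqrt_mul (supNorm_nonneg K), hsqrtE]
        ring

lemma summable_norm_bracketTerm {σ θ : ℝ} (hσ : 0 < σ) (hθ : θ ∈ Set.Ioo (0 : ℝ) 1)
    {m : ℕ} (hm : 2 ≤ m) {K : (Fin (2 * m) → ℤ × ℤ) → ℂ} (hK : inHR K) {z : ℤ → ℂ}
    (hz : inG σ θ z) {N : ℝ} (hN : 1 ≤ N) {l : ℤ} (hl : (m : ℝ) * N ^ 2 ≤ |(l : ℝ)|) :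
    Summable fun j => ‖bracketTerm K z l j‖ := by
  set C := √2 * √(supNorm K) * Real.exp (-(σ * (1 - θ) * N ^ θ) / 2) * gNorm σ θ z ^ m
  refine summable_of_sum_le (c := (C / wt σ θ l) ^ 2) (fun j => norm_nonneg _) fun J => ?_
  have h := sum_wt_mul_sqrt_sum_bracketTerm_le hσ hθ hm hK hz hN (s := {l}) (by simpa using hl) J
  rw [Finset.sum_singleton] at h
  refine (Real.sqrt_le_iff.1 ?_).2
  have hw : 0 < wt σ θ l := Real.exp_pos _
  rwa [le_div_iff₀ hw, mul_comm]

lemma sum_wt_mul_sqrt_actionBracket_le {σ θ : ℝ} (hσ : 0 < σ) (hθ : θ ∈ Set.Ioo (0 : ℝ) 1)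
    {m : ℕ} (hm : 2 ≤ m) {K : (Fin (2 * m) → ℤ × ℤ) → ℂ} (hK : inHR K) {z : ℤ → ℂ}
    (hz : inG σ θ z) {N : ℝ} (hN : 1 ≤ N) {s : Finset ℤ}
    (hs : ∀ l ∈ s, (m : ℝ) * N ^ 2 ≤ |(l : ℝ)|) :
    ∑ l ∈ s, wt σ θ l * √‖actionBracket K l z‖ ≤
      √2 * √(supNorm K) * Real.exp (-(σ * (1 - θ) * N ^ θ) / 2) * gNorm σ θ z ^ m := by
  have hsum := fun l hl => summable_norm_bracketTerm hσ hθ hm hK hz hN (hs l hl)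
  have hlim : Filter.Tendsto
      (fun J => ∑ l ∈ s, wt σ θ l * √(∑ j ∈ J, ‖bracketTerm K z l j‖)) Filter.atTop
      (nhds (∑ l ∈ s, wt σ θ l * √(∑' j, ‖bracketTerm K z l j‖))) :=
    tendsto_finsetSum _ fun l hl => ((hsum l hl).hasSum.sqrt).const_mul _
  refine le_trans (Finset.sum_le_sum fun l hl => ?_) (le_of_tendsto' hlim fun J =>
    sum_wt_mul_sqrt_sum_bracketTerm_le hσ hθ hm hK hz hN hs J)
  exact mul_le_mul_of_nonneg_left (Real.sqrt_le_sqrt (norm_tsum_le_tsum_norm (hsum l hl)))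
    (Real.exp_pos _).le

/-- **Statement 11.** Summed high-frequency estimate for `{I_ℓ, K}` over `|ℓ| ≥ m N²`,
for a resonant polynomial `K ∈ H_m^𝓡`. -/
theorem stmt11 (σ θ : ℝ) (hσ : 0 < σ) (hθ : θ ∈ Set.Ioo (0 : ℝ) 1)
    (m : ℕ) (hm : 2 ≤ m) (K : (Fin (2 * m) → ℤ × ℤ) → ℂ) (hK : inHR K)
    (z : ℤ → ℂ) (hz : inG σ θ z) (N : ℝ) (hN : 1 ≤ N) :
    Summable (fun ℓ : ℤ => if (m : ℝ) * N ^ 2 ≤ |(ℓ : ℝ)| then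
        wt σ θ ℓ * Real.sqrt ‖actionBracket K ℓ z‖ else 0) ∧
    (∑' ℓ : ℤ, if (m : ℝ) * N ^ 2 ≤ |(ℓ : ℝ)| then
        wt σ θ ℓ * Real.sqrt ‖actionBracket K ℓ z‖ else 0) ≤
      Real.sqrt 2 * Real.sqrt (supNorm K) * Real.exp (-(σ * (1 - θ) * N ^ θ) / 2) *
        gNorm σ θ z ^ m := by
  set f : ℤ → ℝ := fun ℓ => if (m : ℝ) * N ^ 2 ≤ |(ℓ : ℝ)| then
    wt σ θ ℓ * Real.sqrt ‖actionBracket K ℓ z‖ else 0 with hf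
  have hf0 : ∀ ℓ, 0 ≤ f ℓ := fun ℓ => by
    simp only [hf]
    split_ifs
    · exact mul_nonneg (Real.exp_pos _).le (Real.sqrt_nonneg _)
    · exact le_rfl
  have hbound : ∀ s : Finset ℤ, ∑ ℓ ∈ s, f ℓ ≤ Real.sqrt 2 * Real.sqrt (supNorm K) *
      Real.exp (-(σ * (1 - θ) * N ^ θ) / 2) * gNorm σ θ z ^ m := fun s => by
    rw [hf, ← Finset.sum_filter]
    exact sum_wt_mul_sqrt_actionBracket_le hσ hθ hm hK hz hN fun ℓ h => (Finset.mem_filter.1 h).2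
  exact ⟨summable_of_sum_le hf0 hbound, Real.tsum_le_of_sum_le hf0 hbound⟩
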